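/- arXiv:1903.09337 — 2 statements merged into one kernel-verified Lean document; each statement's English description precedes it below -/
import Mathlib

section
/- Let (Ω,𝒜,μ) be a probability space, T:Ω→Ω measure preserving, and χ:Ω→[0,∞) measurable with μ(χ>x)=L(x)/x^α for all x>0, where L is slowly varying and 0<α<1. Let (b_n) be a sequence of natural numbers tending to infinity with b_n=o(n), put ζ_n := b_n^{2/3} and g_n := F^←(1−(b_n−ζ_n)/n). Then ∫ T_n^{g_n}χ dμ ∼ d_n as n→∞, where d_n := (α/(1-α))·n^{1/α}·b_n^{1-1/α}·ℓ^#((n/b_n)^{1/α}). -/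
open MeasureTheory Filter Topology ENNReal

noncomputable section

/-- Birkhoff sum `S_n χ = ∑_{k=1}^n χ ∘ T^{k-1}`. -/
def birkhoffSumN {Ω : Type*} (T : Ω → Ω) (χ : Ω → ℝ) (n : ℕ) (ω : Ω) : ℝ :=
  ∑ k ∈ Finset.range n, χ (T^[k] ω)

/-- Trimmed sum `S_n^b χ`: the sum of the `n - b` smallest values among
`χ(ω), χ(Tω), …, χ(T^{n-1}ω)`. -/
def trimmedSumN {Ω : Type*} (T : Ω → Ω) (χ : Ω → ℝ) (n b : ℕ) (ω : Ω) : ℝ :=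
  (((((List.range n).map fun k => χ (T^[k] ω))).mergeSort (fun a b => a ≤ b)).take (n - b)).sum

/-- Truncated sum `T_n^f χ = ∑_{k=1}^n (χ·1_{χ ≤ f}) ∘ T^{k-1}`. -/
def truncSumN {Ω : Type*} (T : Ω → Ω) (χ : Ω → ℝ) (n : ℕ) (f : ℝ) (ω : Ω) : ℝ :=
  ∑ k ∈ Finset.range n, if χ (T^[k] ω) ≤ f then χ (T^[k] ω) else 0

/-- A function `L` is slowly varying if `L(cx)/L(x) → 1` as `x → ∞`, for every `c > 0`. -/
def SlowlyVarying (L : ℝ → ℝ) : Prop :=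
  ∀ c : ℝ, 0 < c → Tendsto (fun x => L (c * x) / L x) atTop (𝓝 1)

/-- `ls` is a de Bruijn conjugate of the slowly varying function `Lt`. -/
def IsDeBruijnConjugate (Lt ls : ℝ → ℝ) : Prop :=
  SlowlyVarying ls ∧
  Tendsto (fun x => Lt x * ls (x * Lt x)) atTop (𝓝 1) ∧
  Tendsto (fun x => ls x * Lt (x * ls x)) atTop (𝓝 1)

/-- The measure of dependence `ψ(ℬ,𝒞)` between two sub-σ-fields. -/
def psiDep {Ω : Type*} [MeasurableSpace Ω] (μ : Measure Ω)
    (B C : MeasurableSpace Ω) : ℝ≥0∞ :=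
  ⨆ (b : Set Ω) (c : Set Ω) (_ : MeasurableSet[B] b) (_ : MeasurableSet[C] c)
    (_ : 0 < μ b) (_ : 0 < μ c),
    ENNReal.ofReal |(μ (b ∩ c)).toReal / ((μ b).toReal * (μ c).toReal) - 1|

/-- The σ-field generated by `X_k = χ ∘ T^{k-1}` for `J ≤ k ≤ L`. -/
def sigmaIcc {Ω : Type*} [MeasurableSpace Ω] (T : Ω → Ω) (χ : Ω → ℝ) (J L : ℕ) :
    MeasurableSpace Ω :=
  ⨆ k ∈ Set.Icc J L, MeasurableSpace.comap (fun ω => χ (T^[k - 1] ω)) inferInstance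

/-- The σ-field generated by `X_k = χ ∘ T^{k-1}` for `k ≥ J`. -/
def sigmaIci {Ω : Type*} [MeasurableSpace Ω] (T : Ω → Ω) (χ : Ω → ℝ) (J : ℕ) :
    MeasurableSpace Ω :=
  ⨆ k ∈ Set.Ici J, MeasurableSpace.comap (fun ω => χ (T^[k - 1] ω)) inferInstance

/-- The `n`-th ψ-mixing coefficient of the sequence `(χ ∘ T^{k-1})_{k ≥ 1}`. -/
def psiCoeff {Ω : Type*} [MeasurableSpace Ω] (μ : Measure Ω) (T : Ω → Ω) (χ : Ω → ℝ)
    (n : ℕ) : ℝ≥0∞ :=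
  ⨆ (k : ℕ) (_ : 1 ≤ k), psiDep μ (sigmaIcc T χ 1 k) (sigmaIci T χ (k + n))

/-- A bounded operator `U` has a spectral gap: `U = λ·P + N` with `P` a one-dimensional
projection, `ρ(N) < |λ|`, and `PN = NP = 0`. -/
def HasSpectralGap {F : Type*} [NormedAddCommGroup F] [NormedSpace ℝ F] [CompleteSpace F]
    (U : F →L[ℝ] F) : Prop :=
  ∃ (lam : ℝ) (P N : F →L[ℝ] F),
    U = lam • P + N ∧ P.comp P = P ∧
    Module.finrank ℝ (LinearMap.range (P : F →ₗ[ℝ] F)) = 1 ∧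
    spectralRadius ℝ N < ENNReal.ofReal |lam| ∧
    P.comp N = 0 ∧ N.comp P = 0

/-- Property ℭ: `μ` is a `T`-invariant mixing probability measure, `ℱ` (realized as a Banach
algebra `F` of measurable functions via the injective algebra homomorphism `ι`) contains the
constants, dominates the sup norm, and the transfer operator restricts to a bounded operator
on `F` with a spectral gap. -/
structure PropertyC {Ω : Type*} [MeasurableSpace Ω] (T : Ω → Ω) (μ : Measure Ω)
    {F : Type*} [NormedRing F] [NormedAlgebra ℝ F] [CompleteSpace F]
    (ι : F →ₐ[ℝ] Ω → ℝ) : Prop where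
  prob : IsProbabilityMeasure μ
  invariant : MeasurePreserving T μ μ
  mixing : ∀ A B : Set Ω, MeasurableSet A → MeasurableSet B →
    Tendsto (fun n => μ (A ∩ T^[n] ⁻¹' B)) atTop (𝓝 (μ A * μ B))
  inj : Function.Injective ι
  measurable_mem : ∀ f : F, Measurable (ι f)
  norm_ge_sup : ∀ (f : F) (ω : Ω), |ι f ω| ≤ ‖f‖
  transfer : ∃ That : F →L[ℝ] F,
    (∀ (f : F) (g : Ω → ℝ), Measurable g → (∃ C, ∀ ω, |g ω| ≤ C) →
      ∫ ω, ι (That f) ω * g ω ∂μ = ∫ ω, ι f ω * g (T ω) ∂μ) ∧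
    HasSpectralGap That

/-- Property 𝔇: Property ℭ together with the norm control on truncations of the
nonnegative observable `χ`. -/
structure PropertyD {Ω : Type*} [MeasurableSpace Ω] (T : Ω → Ω) (μ : Measure Ω)
    {F : Type*} [NormedRing F] [NormedAlgebra ℝ F] [CompleteSpace F]
    (ι : F →ₐ[ℝ] Ω → ℝ) (χ : Ω → ℝ) extends PropertyC T μ ι : Prop where
  chi_nonneg : ∀ ω, 0 ≤ χ ω
  chi_meas : Measurable χ
  norm_bound : ∃ K₁ > (0 : ℝ), ∀ ℓ : ℝ, 0 ≤ ℓ →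
    (∃ f : F, ι f = (fun ω => if χ ω ≤ ℓ then χ ω else 0) ∧ ‖f‖ ≤ K₁ * ℓ) ∧
    (∃ g : F, ι g = (fun ω => if ℓ < χ ω then (1 : ℝ) else 0) ∧ ‖g‖ ≤ K₁)

/-- The distribution function `F(x) = μ(χ ≤ x)`. -/
def distF {Ω : Type*} [MeasurableSpace Ω] (μ : Measure Ω) (χ : Ω → ℝ) (x : ℝ) : ℝ :=
  (μ {ω | χ ω ≤ x}).toReal

/-- Generalized inverse `F^←(y) = inf {x | F(x) ≥ y}`. -/
def genInv (F : ℝ → ℝ) (y : ℝ) : ℝ := sInf {x : ℝ | y ≤ F x}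

/-- `g_n = F^←(1 - (b_n - ζ_n)/n)` where `ζ_n = b_n^{2/3}`. -/
def gSeq {Ω : Type*} [MeasurableSpace Ω] (μ : Measure Ω) (χ : Ω → ℝ) (b : ℕ → ℕ)
    (n : ℕ) : ℝ :=
  genInv (distF μ χ) (1 - ((b n : ℝ) - (b n : ℝ) ^ ((2 : ℝ) / 3)) / n)

/-- The norming sequence `d_n = (α/(1-α))·n^{1/α}·b_n^{1-1/α}·ℓ^#((n/b_n)^{1/α})`. -/
def dSeq (α : ℝ) (ls : ℝ → ℝ) (b : ℕ → ℕ) (n : ℕ) : ℝ :=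
  α / (1 - α) * (n : ℝ) ^ (1 / α) * (b n : ℝ) ^ (1 - 1 / α) *
    ls (((n : ℝ) / (b n : ℝ)) ^ (1 / α))

end

/-- Abstract data: a monotone regularly varying tail function. -/
structure TailRV (G : ℝ → ℝ) (α : ℝ) : Prop where
  anti : Antitone G
  pos : ∀ x, 0 < x → 0 < G x
  le_one : ∀ x, G x ≤ 1
  rv : ∀ c, 0 < c → Tendsto (fun x => G (c * x) / G x) atTop (𝓝 (c ^ (-α)))

theorem TailRV.potter {G : ℝ → ℝ} {α β : ℝ} (h : TailRV G α) (hα : 0 < α) (hβ : α < β) :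
    ∃ C X : ℝ, 0 < X ∧ ∀ x y, X ≤ x → 0 < y → y ≤ x → y ^ β * G y ≤ C * (x ^ β * G x) := by
  have hβ0 : 0 < β := hα.trans hβ
  have h1 : ((2:ℝ) ^ (-β)) < (2:ℝ) ^ (-α) :=
    Real.rpow_lt_rpow_of_exponent_lt (by norm_num) (by linarith)
  obtain ⟨X', hX'⟩ := eventually_atTop.1 ((tendsto_order.1 (h.rv 2 (by norm_num))).1 _ h1)
  set X := max X' 1 with hX
  have hX0 : 0 < X := lt_of_lt_of_le one_pos (le_max_right _ _)
  -- step
  have step : ∀ z, X ≤ z → z ^ β * G z ≤ (2 * z) ^ β * G (2 * z) := by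
    intro z hz
    have hz0 : 0 < z := hX0.trans_le hz
    have := hX' z ((le_max_left _ _).trans hz)
    rw [lt_div_iff₀ (h.pos z hz0)] at this
    rw [Real.mul_rpow (by norm_num) hz0.le]
    have h2 : (2:ℝ) ^ β * (2:ℝ) ^ (-β) = 1 := by
      rw [← Real.rpow_add (by norm_num)]; simp
    have hzp : 0 < z ^ β := Real.rpow_pos_of_pos hz0 _
    have h2p : 0 < (2:ℝ) ^ β := by positivity
    calc z ^ β * G z = z ^ β * ((2:ℝ) ^ β * ((2:ℝ) ^ (-β) * G z)) := by
          rw [← mul_assoc ((2:ℝ)^β), h2, one_mul]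
      _ ≤ z ^ β * ((2:ℝ) ^ β * G (2 * z)) := by gcongr
      _ = _ := by ring
  set C0 := (2 * X) ^ β / (X ^ β * G (2 * X)) with hC0
  have hG2X : 0 < G (2 * X) := h.pos _ (by positivity)
  set C := max C0 ((2:ℝ) ^ β) with hC
  have hCpos : 0 < C := lt_of_lt_of_le (by positivity : (0:ℝ) < (2:ℝ)^β) (le_max_right _ _)
  refine ⟨C, X, hX0, ?_⟩
  have key : ∀ k : ℕ, ∀ x y, X ≤ x → x ≤ 2 ^ (k + 1) * X → 0 < y → y ≤ x →
      y ^ β * G y ≤ C * (x ^ β * G x) := by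
    intro k
    have base : ∀ x y, X ≤ x → x ≤ 2 * X → 0 < y → y ≤ x →
        y ^ β * G y ≤ C * (x ^ β * G x) := by
      intro x y hx hx2 hy hyx
      have hx0 : 0 < x := hX0.trans_le hx
      have hXb : 0 < X ^ β := Real.rpow_pos_of_pos hX0 _
      calc y ^ β * G y ≤ (2 * X) ^ β * 1 := by
            apply mul_le_mul (Real.rpow_le_rpow hy.le (hyx.trans hx2) hβ0.le) (h.le_one _)
              (h.pos _ hy).le (by positivity)
        _ = C0 * (X ^ β * G (2 * X)) := by rw [hC0]; field_simp
        _ ≤ C * (X ^ β * G (2 * X)) := by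
            gcongr; exact le_max_left _ _
        _ ≤ C * (x ^ β * G x) := by
            gcongr
            exact h.anti hx2
    induction k with
    | zero => intro x y hx hx2; exact base x y hx (by simpa using hx2)
    | succ k ih =>
      intro x y hx hx2 hy hyx
      rcases le_total x (2 * X) with hc | hc
      · exact base x y hx hc hy hyx
      have hx0 : 0 < x := hX0.trans_le hx
      have hst := step (x / 2) (by linarith)
      rw [mul_div_cancel₀ _ (by norm_num : (2:ℝ) ≠ 0)] at hst
      rcases le_total y (x / 2) with hy2 | hy2
      · have := ih (x / 2) y (by linarith) (by rw [pow_succ] at hx2; linarith) hy hy2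
        exact this.trans (mul_le_mul_of_nonneg_left hst hCpos.le)
      · have hGx := h.pos x hx0
        calc y ^ β * G y ≤ x ^ β * G (x / 2) := by
              apply mul_le_mul (Real.rpow_le_rpow hy.le hyx hβ0.le) (h.anti hy2)
                (h.pos _ hy).le (by positivity)
          _ = (2:ℝ) ^ β * ((x / 2) ^ β * G (x / 2)) := by
              rw [← mul_assoc, ← Real.mul_rpow (by norm_num) (by positivity)]
              congr 2; ring
          _ ≤ (2:ℝ) ^ β * (x ^ β * G x) := by gcongr
          _ ≤ C * (x ^ β * G x) := by gcongr; exact le_max_right _ _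
  intro x y hx hy hyx
  obtain ⟨k, hk⟩ := pow_unbounded_of_one_lt (x / X) (by norm_num : (1:ℝ) < 2)
  refine key k x y hx ?_ hy hyx
  rw [div_lt_iff₀ hX0] at hk
  rw [pow_succ]
  have : 0 < x := hX0.trans_le hx
  linarith

theorem TailRV.karamata {G : ℝ → ℝ} {α : ℝ} (h : TailRV G α) (hα : 0 < α) (hα1 : α < 1) :
    Tendsto (fun x => ∫ s in (0:ℝ)..1, (G (x * s) / G x - 1)) atTop (𝓝 (α / (1 - α))) := by
  obtain ⟨β, hβ, hβ1⟩ := exists_between hα1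
  obtain ⟨C, X, hX0, hP⟩ := h.potter hα hβ
  have hlim : ∫ s in (0:ℝ)..1, (s ^ (-α) - 1) = α / (1 - α) := by
    rw [intervalIntegral.integral_sub (intervalIntegral.intervalIntegrable_rpow' (by linarith))
      (by simp), integral_rpow (Or.inl (by linarith))]
    have : (1 - α) ≠ 0 := by linarith
    have h2 : -α + 1 ≠ 0 := by linarith
    simp [Real.zero_rpow h2]
    field_simp
    ring
  rw [← hlim]
  apply intervalIntegral.tendsto_integral_filter_of_dominated_convergence
    (fun s => C * s ^ (-β) + 1)
  · refine Eventually.of_forall fun x => ?_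
    apply Measurable.aestronglyMeasurable
    have := h.anti.measurable
    fun_prop
  · filter_upwards [eventually_ge_atTop X] with x hx
    refine Eventually.of_forall fun s hs => ?_
    rw [Set.uIoc_of_le zero_le_one] at hs
    have hx0 : 0 < x := hX0.trans_le hx
    have hs0 := hs.1
    have hG := h.pos x hx0
    have hGs := h.pos (x * s) (by positivity)
    have := hP x (x * s) hx (by positivity) (by nlinarith [hs.2])
    rw [Real.mul_rpow hx0.le hs0.le] at this
    have hxp : 0 < x ^ β := Real.rpow_pos_of_pos hx0 _
    have hsp : 0 < s ^ β := Real.rpow_pos_of_pos hs0 _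
    have h3 : G (x * s) / G x ≤ C * s ^ (-β) := by
      rw [Real.rpow_neg hs0.le, div_le_iff₀ hG, ← div_eq_mul_inv, div_mul_eq_mul_div,
        le_div_iff₀ hsp]
      have h4 : x ^ β * (G (x * s) * s ^ β) ≤ x ^ β * (C * G x) := by linarith
      exact le_of_mul_le_mul_left h4 hxp
    have h5 : 0 < G (x * s) / G x := by positivity
    rw [Real.norm_eq_abs, abs_le]
    constructor <;> linarith
  · apply IntervalIntegrable.add _ (by simp)
    exact (intervalIntegral.intervalIntegrable_rpow' (by linarith)).const_mul C
  · refine Eventually.of_forall fun s hs => ?_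
    rw [Set.uIoc_of_le zero_le_one] at hs
    have := (h.rv s hs.1).sub_const 1
    simpa [mul_comm] using this

theorem exists_gt_one_rpow {α a : ℝ} (ha : a < 1) : ∃ c : ℝ, 1 < c ∧ a < c ^ (-α) := by
  have hc : ContinuousAt (fun c : ℝ => c ^ (-α)) 1 :=
    Real.continuousAt_rpow_const _ _ (Or.inl one_ne_zero)
  have h1 : ∀ᶠ c : ℝ in 𝓝[>] 1, a < c ^ (-α) := by
    apply Filter.Eventually.filter_mono nhdsWithin_le_nhds
    apply hc.eventually (lt_mem_nhds (by simpa using ha))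
  obtain ⟨c, h, h'⟩ := (h1.and self_mem_nhdsWithin).exists
  exact ⟨c, h', h⟩

theorem exists_lt_one_rpow {α a : ℝ} (ha : 1 < a) : ∃ c : ℝ, 0 < c ∧ c < 1 ∧ c ^ (-α) < a := by
  have hc : ContinuousAt (fun c : ℝ => c ^ (-α)) 1 :=
    Real.continuousAt_rpow_const _ _ (Or.inl one_ne_zero)
  have h1 : ∀ᶠ c : ℝ in 𝓝[<] 1, c ^ (-α) < a := by
    apply Filter.Eventually.filter_mono nhdsWithin_le_nhds
    apply hc.eventually (gt_mem_nhds (by simpa using ha))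
  have h2 : ∀ᶠ c : ℝ in 𝓝[<] 1, 0 < c :=
    Filter.Eventually.filter_mono nhdsWithin_le_nhds (lt_mem_nhds one_pos)
  obtain ⟨c, ⟨h, h0⟩, h'⟩ := ((h1.and h2).and self_mem_nhdsWithin).exists
  exact ⟨c, h0, h', h⟩

theorem TailRV.equiv {G : ℝ → ℝ} {α : ℝ} (h : TailRV G α)
    {u v : ℕ → ℝ} (hv : Tendsto v atTop atTop)
    (huv : Tendsto (fun n => u n / v n) atTop (𝓝 1)) :
    Tendsto (fun n => G (u n) / G (v n)) atTop (𝓝 1) := by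
  refine tendsto_order.2 ⟨fun a ha => ?_, fun a ha => ?_⟩
  · obtain ⟨c, hc1, hca⟩ := exists_gt_one_rpow (α := α) ha
    filter_upwards [hv.eventually ((tendsto_order.1 (h.rv c (by linarith))).1 a hca),
      (tendsto_order.1 huv).2 c hc1, hv.eventually_gt_atTop 0] with n h1 h2 h3
    refine h1.trans_le ?_
    have := h.pos _ h3
    rw [div_lt_iff₀ h3] at h2
    gcongr
    exact h.anti h2.le
  · obtain ⟨c, hc0, hc1, hca⟩ := exists_lt_one_rpow (α := α) ha
    filter_upwards [hv.eventually ((tendsto_order.1 (h.rv c hc0)).2 a hca),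
      (tendsto_order.1 huv).1 c hc1, hv.eventually_gt_atTop 0] with n h1 h2 h3
    refine lt_of_le_of_lt ?_ h1
    have := h.pos _ h3
    rw [lt_div_iff₀ h3] at h2
    gcongr
    exact h.anti h2.le

/-- `g n` is a generalized inverse of `G` at `p n`. -/
theorem TailRV.inv_equiv {G : ℝ → ℝ} {α : ℝ} (h : TailRV G α) (hα : 0 < α)
    {g p y : ℕ → ℝ} (hy : Tendsto y atTop atTop)
    (hpy : Tendsto (fun n => p n / G (y n)) atTop (𝓝 1))
    (h1 : ∀ᶠ n in atTop, ∀ x, G x ≤ p n → g n ≤ x)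
    (h2 : ∀ᶠ n in atTop, ∀ x, p n < G x → x ≤ g n) :
    Tendsto (fun n => g n / y n) atTop (𝓝 1) := by
  have up : ∀ c, 1 < c → ∀ᶠ n in atTop, g n ≤ c * y n := by
    intro c hc
    have hlt : c ^ (-α) < 1 := Real.rpow_lt_one_of_one_lt_of_neg hc (by linarith)
    obtain ⟨m, hm1, hm2⟩ := exists_between hlt
    filter_upwards [hy.eventually ((tendsto_order.1 (h.rv c (by linarith))).2 m hm1),
      (tendsto_order.1 hpy).1 m hm2, h1, hy.eventually_gt_atTop 0] with n k1 k2 k3 k4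
    apply k3
    have := h.pos _ k4
    exact ((div_lt_div_iff_of_pos_right this).1 (k1.trans k2)).le
  have lo : ∀ c, 0 < c → c < 1 → ∀ᶠ n in atTop, c * y n ≤ g n := by
    intro c hc0 hc
    have hlt : 1 < c ^ (-α) := Real.one_lt_rpow_of_pos_of_lt_one_of_neg hc0 hc (by linarith)
    obtain ⟨m, hm1, hm2⟩ := exists_between hlt
    filter_upwards [hy.eventually ((tendsto_order.1 (h.rv c hc0)).1 m hm2),
      (tendsto_order.1 hpy).2 m hm1, h2, hy.eventually_gt_atTop 0] with n k1 k2 k3 k4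
    apply k3
    have := h.pos _ k4
    exact (div_lt_div_iff_of_pos_right this).1 (k2.trans k1)
  refine tendsto_order.2 ⟨fun a ha => ?_, fun a ha => ?_⟩
  · obtain ⟨c, hc0, hc1⟩ := exists_between (max_lt ha one_pos)
    filter_upwards [lo c ((le_max_right _ _).trans_lt hc0) hc1, hy.eventually_gt_atTop 0]
      with n k1 k2
    rw [lt_div_iff₀ k2]
    have := (le_max_left a 0).trans_lt hc0
    nlinarith
  · obtain ⟨c, hc0, hc1⟩ := exists_between ha
    filter_upwards [up c hc0, hy.eventually_gt_atTop 0] with n k1 k2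
    rw [div_lt_iff₀ k2]
    nlinarith

theorem TailRV.tendsto_zero {G : ℝ → ℝ} {α : ℝ} (h : TailRV G α) (hα : 0 < α) :
    Tendsto G atTop (𝓝 0) := by
  have hnn : ∀ x, 0 ≤ G x := fun x =>
    (h.pos (max x 1) (lt_of_lt_of_le one_pos (le_max_right _ _))).le.trans
      (h.anti (le_max_left _ _))
  have hb : BddBelow (Set.range G) := ⟨0, by rintro _ ⟨x, rfl⟩; exact hnn x⟩
  have hl := tendsto_atTop_ciInf h.anti hb
  set l := ⨅ i, G i with hldef
  by_cases hl0 : l = 0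
  · rwa [hl0] at hl
  exfalso
  have h2 : Tendsto (fun x : ℝ => G (2 * x)) atTop (𝓝 l) :=
    hl.comp (tendsto_id.const_mul_atTop (by norm_num))
  have h3 := h2.div hl hl0
  rw [div_self hl0] at h3
  have h4 := tendsto_nhds_unique h3 (h.rv 2 (by norm_num))
  have : (2:ℝ) ^ (-α) < 1 := Real.rpow_lt_one_of_one_lt_of_neg (by norm_num) (by linarith)
  linarith

theorem SlowlyVarying.eventually_pos {ls : ℝ → ℝ} (h : SlowlyVarying ls)
    (hf : ∃ᶠ x in atTop, 0 < ls x) : ∀ᶠ x in atTop, 0 < ls x := by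
  have ev : ∀ c, 0 < c → ∀ᶠ x in atTop, (0 < ls (c * x) ↔ 0 < ls x) := by
    intro c hc
    filter_upwards [(tendsto_order.1 (h c hc)).1 0 one_pos] with x hx
    rcases div_pos_iff.1 hx with ⟨h1, h2⟩ | ⟨h1, h2⟩
    · exact ⟨fun _ => h2, fun _ => h1⟩
    · exact ⟨fun h3 => absurd h3 h1.not_gt, fun h3 => absurd h3 h2.not_gt⟩
  obtain ⟨N, hN⟩ := eventually_atTop.1 (ev 2 (by norm_num))
  have pw : ∀ x, max N 1 ≤ x → ∀ k : ℕ, (0 < ls (2 ^ k * x) ↔ 0 < ls x) := by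
    intro x hx k
    induction k with
    | zero => simp
    | succ k ih =>
      rw [← ih, pow_succ', mul_assoc]
      apply hN
      have h1 : (1:ℝ) ≤ 2 ^ k := one_le_pow₀ (by norm_num)
      have h2 := (le_max_right N 1).trans hx
      have h3 := (le_max_left N 1).trans hx
      nlinarith
  obtain ⟨x, hxpos, hx⟩ := (hf.and_eventually (eventually_ge_atTop (max N 1))).exists
  filter_upwards [eventually_ge_atTop (max N 1)] with y hy
  have hx0 : 0 < x := lt_of_lt_of_le one_pos ((le_max_right N 1).trans hx)
  have hy0 : 0 < y := lt_of_lt_of_le one_pos ((le_max_right N 1).trans hy)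
  have ht : Tendsto (fun k : ℕ => (2:ℝ) ^ k * x) atTop atTop :=
    (tendsto_pow_atTop_atTop_of_one_lt (by norm_num)).atTop_mul_const hx0
  obtain ⟨k, hk⟩ := (ht.eventually (ev (y / x) (by positivity))).exists
  have e : y / x * (2 ^ k * x) = 2 ^ k * y := by field_simp
  rw [e, pw x hx, pw y hy] at hk
  exact hk.2 hxpos

/-- Expectation of the truncated observable by the layer cake formula. -/
theorem integral_trunc {Ω : Type*} [MeasurableSpace Ω] (μ : Measure Ω) [IsProbabilityMeasure μ]
    (χ : Ω → ℝ) (hχm : Measurable χ) (hχ0 : ∀ ω, 0 ≤ χ ω) (G : ℝ → ℝ)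
    (hG : ∀ x, G x = (μ {ω | x < χ ω}).toReal) (g : ℝ) (hg : 0 < g) (hGg : 0 < G g) :
    ∫ ω, (if χ ω ≤ g then χ ω else 0) ∂μ
      = g * G g * ∫ s in (0:ℝ)..1, (G (g * s) / G g - 1) := by
  have hm : Measurable (fun ω => if χ ω ≤ g then χ ω else 0) :=
    Measurable.ite (measurableSet_le hχm measurable_const) hχm measurable_const
  have hInt : Integrable (fun ω => if χ ω ≤ g then χ ω else 0) μ := by
    refine Integrable.of_bound hm.aestronglyMeasurable g (Eventually.of_forall fun ω => ?_)
    split_ifs with h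
    · rw [Real.norm_eq_abs, abs_of_nonneg (hχ0 ω)]; exact h
    · simpa using hg.le
  have hnn : 0 ≤ᵐ[μ] (fun ω => if χ ω ≤ g then χ ω else 0) :=
    Eventually.of_forall fun ω => by
      show (0:ℝ) ≤ if χ ω ≤ g then χ ω else 0
      split_ifs
      · exact hχ0 ω
      · exact le_rfl
  rw [hInt.integral_eq_integral_meas_lt hnn]
  have h1 : ∀ t ∈ Set.Ioi (0:ℝ), μ.real {a | t < if χ a ≤ g then χ a else 0}
      = Set.indicator (Set.Ioc 0 g) (fun t => G t - G g) t := by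
    intro t ht
    have ht0 : (0:ℝ) < t := ht
    by_cases htg : t ≤ g
    · rw [Set.indicator_of_mem (show t ∈ Set.Ioc 0 g from ⟨ht0, htg⟩)]
      have e : {a | t < if χ a ≤ g then χ a else 0} = {a | t < χ a} \ {a | g < χ a} := by
        ext a
        simp only [Set.mem_setOf_eq, Set.mem_sdiff, not_lt]
        split_ifs with h
        · simp [h]
        · simp [h, ht0.le]
      have hsub : {a | g < χ a} ⊆ {a | t < χ a} :=
        fun a (ha : g < χ a) => lt_of_le_of_lt htg ha
      have hms : MeasurableSet {a | g < χ a} := measurableSet_lt measurable_const hχm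
      rw [e, measureReal_sdiff hsub hms, hG, hG]
      rfl
    · rw [Set.indicator_of_notMem (fun h => htg h.2)]
      have e : {a | t < if χ a ≤ g then χ a else 0} = ∅ := by
        ext a
        simp only [Set.mem_setOf_eq, Set.mem_empty_iff_false, iff_false, not_lt]
        split_ifs with h
        · exact h.trans (not_le.1 htg).le
        · exact ht0.le
      rw [e]; simp
  rw [setIntegral_congr_fun measurableSet_Ioi h1, setIntegral_indicator measurableSet_Ioc,
    Set.inter_eq_self_of_subset_right (show Set.Ioc 0 g ⊆ Set.Ioi 0 from fun x hx => hx.1),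
    ← intervalIntegral.integral_of_le hg.le]
  have h2 := intervalIntegral.integral_comp_mul_left (a := 0) (b := 1) (fun t => G t - G g) hg.ne'
  simp only [mul_zero, mul_one, smul_eq_mul] at h2
  have h3 : ∀ s, G (g * s) / G g - 1 = (G g)⁻¹ * (G (g * s) - G g) := by
    intro s; field_simp
  simp only [h3]
  rw [intervalIntegral.integral_const_mul, h2]
  field_simp

theorem integral_truncSumN {Ω : Type*} [MeasurableSpace Ω] (μ : Measure Ω)
    [IsProbabilityMeasure μ]
    (T : Ω → Ω) (hT : MeasurePreserving T μ μ)
    (χ : Ω → ℝ) (hχm : Measurable χ) (hχ0 : ∀ ω, 0 ≤ χ ω) (n : ℕ) (g : ℝ) (hg : 0 < g) :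
    ∫ ω, truncSumN T χ n g ω ∂μ = n * ∫ ω, (if χ ω ≤ g then χ ω else 0) ∂μ := by
  have hm : Measurable (fun ω => if χ ω ≤ g then χ ω else 0) :=
    Measurable.ite (measurableSet_le hχm measurable_const) hχm measurable_const
  have hInt : Integrable (fun ω => if χ ω ≤ g then χ ω else 0) μ := by
    refine Integrable.of_bound hm.aestronglyMeasurable g (Eventually.of_forall fun ω => ?_)
    split_ifs with h
    · rw [Real.norm_eq_abs, abs_of_nonneg (hχ0 ω)]; exact h
    · simpa using hg.le
  unfold truncSumN
  rw [integral_finsetSum]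
  · have : ∀ k ∈ Finset.range n, ∫ ω, (if χ (T^[k] ω) ≤ g then χ (T^[k] ω) else 0) ∂μ
        = ∫ ω, (if χ ω ≤ g then χ ω else 0) ∂μ := by
      intro k _
      have hk := hT.iterate k
      conv_rhs => rw [← hk.map_eq]
      rw [integral_map hk.measurable.aemeasurable hm.aestronglyMeasurable]
    rw [Finset.sum_congr rfl this]
    simp
  · intro k _
    exact (hT.iterate k).integrable_comp_of_integrable hInt

theorem truncated_sum_asymptotic_dn
    {Ω : Type*} [MeasurableSpace Ω] (μ : Measure Ω) [IsProbabilityMeasure μ]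
    (T : Ω → Ω) (hT : MeasurePreserving T μ μ)
    (χ : Ω → ℝ) (hχm : Measurable χ) (hχ0 : ∀ ω, 0 ≤ χ ω)
    (L : ℝ → ℝ) (hL : SlowlyVarying L) (hLpos : ∀ x : ℝ, 0 < x → 0 < L x)
    {α : ℝ} (hα0 : 0 < α) (hα1 : α < 1)
    (htail : ∀ x : ℝ, 0 < x → (μ {ω | x < χ ω}).toReal = L x / x ^ α)
    (b : ℕ → ℕ) (hb : Tendsto b atTop atTop)
    (hbo : Tendsto (fun n => (b n : ℝ) / (n : ℝ)) atTop (𝓝 0))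
    (ls : ℝ → ℝ) (hls : IsDeBruijnConjugate (fun x => L x ^ (-(1 / α))) ls)
    :
    Tendsto (fun n => (∫ ω, truncSumN T χ n (gSeq μ χ b n) ω ∂μ) / dSeq α ls b n)
      atTop (𝓝 1) := by
  obtain ⟨hls1, hls2, hls3⟩ := hls
  set G : ℝ → ℝ := fun x => (μ {ω | x < χ ω}).toReal with hGdef
  have hGtail : ∀ x, 0 < x → G x = L x / x ^ α := htail
  have hG : TailRV G α := by
    refine ⟨?_, ?_, ?_, ?_⟩
    · intro x y hxy
      exact ENNReal.toReal_mono (measure_ne_top _ _)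
        (measure_mono fun ω (hω : y < χ ω) => lt_of_le_of_lt hxy hω)
    · intro x hx
      rw [hGtail x hx]
      exact div_pos (hLpos x hx) (Real.rpow_pos_of_pos hx _)
    · intro x
      exact measureReal_le_one
    · intro c hc
      have h1 := (hL c hc).mul_const (c ^ (-α))
      rw [one_mul] at h1
      refine h1.congr' ?_
      filter_upwards [eventually_gt_atTop 0] with x hx
      rw [hGtail x hx, hGtail (c * x) (by positivity), Real.mul_rpow hc.le hx.le,
        Real.rpow_neg hc.le]
      have := hLpos x hx
      have := Real.rpow_pos_of_pos hx α
      have := Real.rpow_pos_of_pos hc α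
      field_simp
  have hG0 := hG.tendsto_zero hα0
  -- `G y ^ (-1/α) = y * L y ^ (-1/α)`
  have hGL : ∀ y, 0 < y → y * L y ^ (-(1 / α)) = G y ^ (-(1 / α)) := by
    intro y hy
    rw [hGtail y hy, Real.div_rpow (hLpos y hy).le (by positivity), ← Real.rpow_mul hy.le,
      mul_neg, mul_one_div_cancel hα0.ne', Real.rpow_neg_one]
    field_simp
  have hXinf : Tendsto (fun y => y * L y ^ (-(1 / α))) atTop atTop := by
    have h1 : Tendsto (fun y => (G y)⁻¹ ^ (1 / α)) atTop atTop := by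
      refine (tendsto_rpow_atTop (by positivity)).comp (Tendsto.inv_tendsto_nhdsGT_zero ?_)
      refine tendsto_nhdsWithin_iff.2 ⟨hG0, ?_⟩
      filter_upwards [eventually_gt_atTop 0] with x hx using hG.pos x hx
    refine h1.congr' ?_
    filter_upwards [eventually_gt_atTop 0] with x hx
    rw [hGL x hx, Real.inv_rpow (hG.pos x hx).le, Real.rpow_neg (hG.pos x hx).le]
  have hlspos : ∀ᶠ x in atTop, 0 < ls x := by
    apply hls1.eventually_pos
    refine hXinf.frequently (Eventually.frequently ?_)
    filter_upwards [(tendsto_order.1 hls2).1 0 one_pos, eventually_gt_atTop 0] with y h1 h2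
    exact pos_of_mul_pos_right h1 (Real.rpow_nonneg (hLpos y h2).le _)
  -- `x ^ α * G (x * ls x) → 1`
  have hconj : Tendsto (fun x => x ^ α * G (x * ls x)) atTop (𝓝 1) := by
    have h1 := hls3.rpow_const (p := -α) (Or.inl one_ne_zero)
    rw [Real.one_rpow] at h1
    refine h1.congr' ?_
    filter_upwards [hlspos, eventually_gt_atTop 0] with x hl hx
    have hy : 0 < x * ls x := by positivity
    have hGy := hG.pos _ hy
    have e : ls x * L (x * ls x) ^ (-(1 / α)) = x⁻¹ * G (x * ls x) ^ (-(1 / α)) := by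
      rw [← hGL _ hy]; field_simp
    show (ls x * L (x * ls x) ^ (-(1 / α))) ^ (-α) = _
    rw [e, Real.mul_rpow (by positivity) (by positivity), ← Real.rpow_mul hGy.le]
    have e2 : -(1 / α) * -α = 1 := by field_simp
    rw [e2, Real.rpow_one, Real.inv_rpow hx.le, Real.rpow_neg hx.le, inv_inv]
  have hyinf : Tendsto (fun x => x * ls x) atTop atTop := by
    have h1 : Tendsto (fun x => G (x * ls x)) atTop (𝓝 0) := by
      have h2 := hconj.mul (tendsto_rpow_neg_atTop hα0)
      rw [mul_zero] at h2
      refine h2.congr' ?_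
      filter_upwards [eventually_gt_atTop 0] with x hx
      have := Real.rpow_pos_of_pos hx α
      rw [Real.rpow_neg hx.le]; field_simp
    refine tendsto_atTop.2 fun M => ?_
    have hM : 0 < G (max M 1) := hG.pos _ (lt_of_lt_of_le one_pos (le_max_right _ _))
    filter_upwards [(tendsto_order.1 h1).2 _ hM] with x hx
    by_contra hc
    exact absurd (hG.anti ((not_le.1 hc).le.trans (le_max_left M 1))) (not_le.2 hx)
  -- sequences
  have hbR : Tendsto (fun n => (b n : ℝ)) atTop atTop := tendsto_natCast_atTop_atTop.comp hb
  have hbpos : ∀ᶠ n in atTop, (0:ℝ) < b n := hbR.eventually_gt_atTop 0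
  have hnpos : ∀ᶠ n : ℕ in atTop, (0:ℝ) < n :=
    tendsto_natCast_atTop_atTop.eventually_gt_atTop 0
  set xs : ℕ → ℝ := fun n => ((n:ℝ) / (b n : ℝ)) ^ (1 / α) with hxs
  set y : ℕ → ℝ := fun n => xs n * ls (xs n) with hydef
  set p : ℕ → ℝ := fun n => ((b n : ℝ) - (b n : ℝ) ^ ((2 : ℝ) / 3)) / n with hpdef
  set g : ℕ → ℝ := fun n => gSeq μ χ b n with hgdef
  have hxinf : Tendsto xs atTop atTop := by
    refine (tendsto_rpow_atTop (by positivity)).comp ?_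
    have h1 : Tendsto (fun n => ((b n : ℝ) / (n : ℝ))⁻¹) atTop atTop := by
      refine Tendsto.inv_tendsto_nhdsGT_zero ?_
      refine tendsto_nhdsWithin_iff.2 ⟨hbo, ?_⟩
      filter_upwards [hbpos, hnpos] with n h1 h2
      exact div_pos h1 h2
    simpa using h1
  have hy : Tendsto y atTop atTop := hyinf.comp hxinf
  have hnGb : Tendsto (fun n : ℕ => (n:ℝ) / b n * G (y n)) atTop (𝓝 1) := by
    refine (hconj.comp hxinf).congr' ?_
    filter_upwards [hbpos, hnpos] with n h1 h2
    show xs n ^ α * G (y n) = _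
    rw [hxs]
    simp only
    rw [← Real.rpow_mul (by positivity), one_div_mul_cancel hα0.ne', Real.rpow_one]
  have hpb : Tendsto (fun n => p n / ((b n : ℝ) / n)) atTop (𝓝 1) := by
    have h1 : Tendsto (fun n => 1 - (b n : ℝ) ^ (-((1:ℝ) / 3))) atTop (𝓝 1) := by
      have := ((tendsto_rpow_neg_atTop (by norm_num : (0:ℝ) < 1 / 3)).comp hbR).const_sub 1
      simpa using this
    refine h1.congr' ?_
    filter_upwards [hbpos, hnpos] with n h1 h2
    have e : (b n : ℝ) ^ ((2:ℝ) / 3) = b n * (b n : ℝ) ^ (-((1:ℝ) / 3)) := by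
      nth_rewrite 2 [← Real.rpow_one (b n : ℝ)]
      rw [← Real.rpow_add h1]; norm_num
    rw [hpdef]
    simp only
    rw [e]
    field_simp
  have hpy : Tendsto (fun n => p n / G (y n)) atTop (𝓝 1) := by
    have h1 := hpb.div hnGb one_ne_zero
    rw [div_one] at h1
    refine h1.congr' ?_
    filter_upwards [hbpos, hnpos, hy.eventually_gt_atTop 0] with n h1 h2 h3
    have := hG.pos _ h3
    show p n / ((b n : ℝ) / n) / ((n:ℝ) / b n * G (y n)) = _
    field_simp
  have hp0 : Tendsto p atTop (𝓝 0) := by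
    have h1 := hpb.mul hbo
    rw [mul_zero] at h1
    refine h1.congr' ?_
    filter_upwards [hbpos, hnpos] with n h1 h2
    field_simp
  have hppos : ∀ᶠ n in atTop, 0 < p n := by
    filter_upwards [hbpos, hnpos, (tendsto_order.1 hpb).1 0 one_pos] with n h1 h2 h3
    have : (0:ℝ) < b n / n := by positivity
    exact (div_pos_iff_of_pos_right this).1 h3
  have hF : ∀ x, distF μ χ x = 1 - G x := by
    intro x
    have e : {ω | χ ω ≤ x} = {ω | x < χ ω}ᶜ := by ext; simp
    show μ.real {ω | χ ω ≤ x} = _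
    rw [e, probReal_compl_eq_one_sub (measurableSet_lt measurable_const hχm)]
    rfl
  have hgset : ∀ n, g n = sInf {x : ℝ | G x ≤ p n} := by
    intro n
    show sInf _ = _
    congr 1
    ext x
    simp only [Set.mem_setOf_eq, hF]
    show 1 - p n ≤ 1 - G x ↔ G x ≤ p n
    constructor <;> intro h <;> linarith
  have hg1 : ∀ᶠ n in atTop, ∀ x, G x ≤ p n → g n ≤ x := by
    filter_upwards [(tendsto_order.1 hp0).2 1 one_pos] with n hn x hx
    rw [hgset]
    refine csInf_le ⟨0, fun z (hz : G z ≤ p n) => ?_⟩ hx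
    by_contra hc
    have hz0 : z < 0 := not_le.1 hc
    have e : {ω | z < χ ω} = Set.univ := by
      ext ω; simp [lt_of_lt_of_le hz0 (hχ0 ω)]
    have : G z = 1 := by
      show (μ {ω | z < χ ω}).toReal = 1
      rw [e]; simp
    linarith
  have hg2 : ∀ᶠ n in atTop, ∀ x, p n < G x → x ≤ g n := by
    filter_upwards [hppos] with n hn x hx
    rw [hgset]
    obtain ⟨z, hz⟩ := ((tendsto_order.1 hG0).2 _ hn).exists
    refine le_csInf ⟨z, hz.le⟩ fun w (hw : G w ≤ p n) => ?_
    by_contra hc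
    have := hG.anti (not_le.1 hc).le
    linarith
  have hgy := hG.inv_equiv hα0 hy hpy hg1 hg2
  have hGgy := hG.equiv hy hgy
  have hginf : Tendsto g atTop atTop := by
    have h1 := hgy.pos_mul_atTop one_pos hy
    refine h1.congr' ?_
    filter_upwards [hy.eventually_gt_atTop 0] with n h3
    field_simp
  have hK := (hG.karamata hα0 hα1).comp hginf
  have hα1' : (0:ℝ) < 1 - α := by linarith
  have hfin := (((hK.mul_const ((1 - α) / α)).mul hgy).mul hGgy).mul hnGb
  have e1 : α / (1 - α) * ((1 - α) / α) * 1 * 1 * 1 = 1 := by field_simp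
  rw [e1] at hfin
  refine hfin.congr' ?_
  filter_upwards [hbpos, hnpos, hy.eventually_gt_atTop 0, hginf.eventually_gt_atTop 0]
    with n h1 h2 h3 h4
  have hGg := hG.pos _ h4
  have hGy := hG.pos _ h3
  have hd : dSeq α ls b n = α / (1 - α) * (b n * y n) := by
    unfold dSeq
    show α / (1 - α) * (n : ℝ) ^ (1 / α) * (b n : ℝ) ^ (1 - 1 / α) * ls (xs n) =
      α / (1 - α) * (b n * (((n:ℝ) / (b n : ℝ)) ^ (1 / α) * ls (xs n)))
    rw [Real.rpow_sub h1, Real.rpow_one, Real.div_rpow h2.le h1.le]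
    ring
  rw [hd, integral_truncSumN μ T hT χ hχm hχ0 n _ h4,
    integral_trunc μ χ hχm hχ0 G (fun _ => rfl) _ h4 hGg]
  show (∫ s in (0:ℝ)..1, (G (g n * s) / G (g n) - 1)) * ((1 - α) / α) * (g n / y n) *
    (G (g n) / G (y n)) * ((n:ℝ) / b n * G (y n)) =
    n * (g n * G (g n) * ∫ s in (0:ℝ)..1, (G (g n * s) / G (g n) - 1)) /
      (α / (1 - α) * (b n * y n))
  generalize (∫ s in (0:ℝ)..1, (G (g n * s) / G (g n) - 1)) = I
  clear_value g y p xs G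
  field_simp
end

section
/- Let (Ω,𝒜,T,μ,ℱ,‖·‖,χ) fulfill Property 𝔇 with μ(χ>x)=L(x)/x^α for all x>0, L slowly varying, 0<α<1; let (b_n) be natural numbers tending to infinity with b_n=o(n); assume at least one ψ-mixing coefficient of (χ∘T^{n-1}) is strictly less than one; put ζ_n := b_n^{2/3} and g_n := F^←(1−(b_n−ζ_n)/n). Then for every ε>0 there exists N∈ℕ such that for all n≥N one has ∫ S_n^{b_n}χ dμ ≤ (1+ε)·∫ T_n^{g_n}χ dμ. -/
open MeasureTheory Filter Topology ENNReal

open MeasureTheory Filter Topology ENNReal Set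

/-- Exceedance count along every `r`-th iterate. -/
noncomputable def cntN {Ω : Type*} (T : Ω → Ω) (χ : Ω → ℝ) (r l : ℕ) (x : ℝ) (ω : Ω) : ℕ :=
  ∑ i ∈ Finset.range l, if x < χ (T^[r * i] ω) then 1 else 0

lemma take_count (l : List ℝ) (hl : l.Pairwise (· ≤ ·)) (b : ℕ) (x : ℝ) :
    (l.take (l.length - b)).countP (fun y => decide (x < y)) ≤
      l.countP (fun y => decide (x < y)) - b := by
  by_cases h0 : (l.take (l.length - b)).countP (fun y => decide (x < y)) = 0
  · omega
  have hpos := Nat.pos_of_ne_zero h0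
  rw [List.countP_pos_iff] at hpos
  obtain ⟨y, hy, hxy⟩ := hpos
  have hb : b ≤ l.length := by
    by_contra hb
    have : l.length - b = 0 := by omega
    rw [this] at hy
    simp at hy
  have hsplit := List.take_append_drop (l.length - b) l
  have h1 : l.countP (fun y => decide (x < y)) =
      (l.take (l.length - b)).countP (fun y => decide (x < y)) +
      (l.drop (l.length - b)).countP (fun y => decide (x < y)) := by
    rw [← List.countP_append, hsplit]
  have h2 : (l.drop (l.length - b)).countP (fun y => decide (x < y)) =
      (l.drop (l.length - b)).length := by
    rw [List.countP_eq_length]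
    intro z hz
    rw [← hsplit, List.pairwise_append] at hl
    have := hl.2.2 y hy z hz
    simp at hxy ⊢
    linarith
  rw [List.length_drop] at h2
  omega

lemma sum_eq_lint (l : List ℝ) (h : ∀ y ∈ l, 0 ≤ y) :
    ENNReal.ofReal l.sum =
      ∫⁻ x in Ioi (0 : ℝ), ((l.countP (fun y => decide (x < y)) : ℕ) : ℝ≥0∞) := by
  induction l with
  | nil => simp
  | cons a l ih =>
    have ha : 0 ≤ a := h a (by simp)
    have hl : ∀ y ∈ l, 0 ≤ y := fun y hy => h y (by simp [hy])
    rw [List.sum_cons, ENNReal.ofReal_add ha (List.sum_nonneg hl), ih hl]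
    have e : ∀ x : ℝ, (((a :: l).countP (fun y => decide (x < y)) : ℕ) : ℝ≥0∞) =
        (Iio a).indicator 1 x + ((l.countP (fun y => decide (x < y)) : ℕ) : ℝ≥0∞) := by
      intro x
      by_cases hx : x < a
      · simp [hx, add_comm]
      · simp [hx]
    simp_rw [e]
    rw [lintegral_add_left (measurable_one.indicator measurableSet_Iio)]
    congr 1
    rw [lintegral_indicator_one measurableSet_Iio, Measure.restrict_apply measurableSet_Iio]
    rw [inter_comm, Ioi_inter_Iio, Real.volume_Ioo, sub_zero]

lemma countP_range {Ω : Type*} (T : Ω → Ω) (χ : Ω → ℝ) (n : ℕ) (x : ℝ) (ω : Ω) :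
    ((List.range n).map fun k => χ (T^[k] ω)).countP (fun y => decide (x < y)) =
      cntN T χ 1 n x ω := by
  unfold cntN
  induction n with
  | zero => simp
  | succ n ih =>
    rw [List.range_succ, List.map_append, List.countP_append, ih, Finset.sum_range_succ]
    simp [List.countP_cons]

lemma trimmed_le {Ω : Type*} (T : Ω → Ω) (χ : Ω → ℝ) (h0 : ∀ ω, 0 ≤ χ ω) (n b : ℕ) (ω : Ω) :
    0 ≤ trimmedSumN T χ n b ω ∧ ENNReal.ofReal (trimmedSumN T χ n b ω) ≤
      ∫⁻ x in Ioi (0 : ℝ), ((cntN T χ 1 n x ω - b : ℕ) : ℝ≥0∞) := by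
  set l0 := (List.range n).map fun k => χ (T^[k] ω) with hl0
  set l := l0.mergeSort (fun a b => a ≤ b) with hl
  have hperm : l.Perm l0 := List.mergeSort_perm _ _
  have hlen : l.length = n := by rw [hperm.length_eq]; simp [hl0]
  have hsort : l.Pairwise (· ≤ ·) := by
    have := List.pairwise_mergeSort (le := fun a b : ℝ => decide (a ≤ b))
      (by intro a b c; simp; exact le_trans) (by intro a b; simp; exact le_total a b) l0
    simpa using this
  have e : trimmedSumN T χ n b ω = (l.take (n - b)).sum := rfl
  have hnn : ∀ y ∈ l.take (n - b), 0 ≤ y := by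
    intro y hy
    have := hperm.mem_iff.1 (List.mem_of_mem_take hy)
    rw [hl0, List.mem_map] at this
    obtain ⟨k, _, rfl⟩ := this
    exact h0 _
  rw [e]
  refine ⟨List.sum_nonneg hnn, ?_⟩
  rw [sum_eq_lint _ hnn]
  refine lintegral_mono fun x => ?_
  have := take_count l hsort b x
  rw [hlen, hperm.countP_eq, countP_range] at this
  exact Nat.cast_le.2 this

lemma psi_ineq {Ω : Type*} [MeasurableSpace Ω] (T : Ω → Ω) (μ : Measure Ω)
    [IsProbabilityMeasure μ] (χ : Ω → ℝ) (r : ℕ) (h : psiCoeff μ T χ r < 1) :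
    ∃ ψ : ℝ, 0 ≤ ψ ∧ ψ < 1 ∧ ∀ k, 1 ≤ k → ∀ B C : Set Ω, MeasurableSet[sigmaIcc T χ 1 k] B →
      MeasurableSet[sigmaIci T χ (k + r)] C →
      |μ.real (B ∩ C) - μ.real B * μ.real C| ≤ ψ * (μ.real B * μ.real C) := by
  refine ⟨(psiCoeff μ T χ r).toReal, ENNReal.toReal_nonneg, ?_, ?_⟩
  · have := (ENNReal.toReal_lt_toReal h.ne_top ENNReal.one_ne_top).2 h
    simpa using this
  intro k hk B C hB hC
  by_cases hB0 : μ B = 0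
  · have : μ (B ∩ C) = 0 := measure_mono_null inter_subset_left hB0
    simp [Measure.real, hB0, this]
  by_cases hC0 : μ C = 0
  · have : μ (B ∩ C) = 0 := measure_mono_null inter_subset_right hC0
    simp [Measure.real, hC0, this]
  have hBp : 0 < μ.real B := ENNReal.toReal_pos hB0 (measure_ne_top _ _)
  have hCp : 0 < μ.real C := ENNReal.toReal_pos hC0 (measure_ne_top _ _)
  have key : ENNReal.ofReal |(μ (B ∩ C)).toReal / ((μ B).toReal * (μ C).toReal) - 1| ≤
      psiCoeff μ T χ r := by
    unfold psiCoeff psiDep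
    refine le_iSup₂_of_le k hk ?_
    refine le_iSup₂_of_le B C ?_
    refine le_iSup₂_of_le hB hC ?_
    exact le_iSup₂_of_le (pos_iff_ne_zero.2 hB0) (pos_iff_ne_zero.2 hC0) le_rfl
  rw [ENNReal.ofReal_le_iff_le_toReal h.ne_top] at key
  have hpos := mul_pos hBp hCp
  have : μ.real (B ∩ C) - μ.real B * μ.real C =
      ((μ (B ∩ C)).toReal / ((μ B).toReal * (μ C).toReal) - 1) * (μ.real B * μ.real C) := by
    have h' : (μ B).toReal * (μ C).toReal ≠ 0 := hpos.ne'
    simp only [Measure.real] at h' ⊢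
    rw [sub_mul, div_mul_cancel₀ _ h', one_mul]
  rw [this, abs_mul, abs_of_pos hpos]
  exact mul_le_mul_of_nonneg_right key hpos.le

/-- Integral of a function of two bounded natural valued variables. -/
lemma int_two {Ω : Type*} [MeasurableSpace Ω] (μ : Measure Ω)
    [IsProbabilityMeasure μ] (S₁ S₂ : Ω → ℕ) (h1 : Measurable S₁) (h2 : Measurable S₂)
    (l₁ l₂ : ℕ) (b1 : ∀ ω, S₁ ω < l₁) (b2 : ∀ ω, S₂ ω < l₂) (G : ℕ → ℕ → ℝ) :
    ∫ ω, G (S₁ ω) (S₂ ω) ∂μ = ∑ i ∈ Finset.range l₁, ∑ j ∈ Finset.range l₂,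
      G i j * μ.real (S₁ ⁻¹' {i} ∩ S₂ ⁻¹' {j}) := by
  have e : ∀ ω, G (S₁ ω) (S₂ ω) = ∑ i ∈ Finset.range l₁, ∑ j ∈ Finset.range l₂,
      (S₁ ⁻¹' {i} ∩ S₂ ⁻¹' {j}).indicator (fun _ => G i j) ω := by
    intro ω
    rw [Finset.sum_eq_single (S₁ ω), Finset.sum_eq_single (S₂ ω)]
    · simp
    · intro j _ hj
      simp [hj.symm]
    · intro h; exact absurd (Finset.mem_range.2 (b2 ω)) h
    · intro j _ hj
      simp [hj.symm]
    · intro h; exact absurd (Finset.mem_range.2 (b1 ω)) h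
  have hm : ∀ i j, MeasurableSet (S₁ ⁻¹' {i} ∩ S₂ ⁻¹' {j}) := fun i j =>
    (h1 (measurableSet_singleton _)).inter (h2 (measurableSet_singleton _))
  have hInteg : ∀ i j, Integrable ((S₁ ⁻¹' {i} ∩ S₂ ⁻¹' {j}).indicator (fun _ => G i j)) μ :=
    fun i j => (integrable_const _).indicator (hm i j)
  simp_rw [e]
  rw [integral_finsetSum _ fun i _ => integrable_finsetSum _ fun j _ => hInteg i j]
  refine Finset.sum_congr rfl fun i _ => ?_
  rw [integral_finsetSum _ fun j _ => hInteg i j]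
  refine Finset.sum_congr rfl fun j _ => ?_
  rw [integral_indicator_const _ (hm i j), smul_eq_mul, mul_comm]

lemma int_one {Ω : Type*} [MeasurableSpace Ω] (μ : Measure Ω)
    [IsProbabilityMeasure μ] (S : Ω → ℕ) (h1 : Measurable S)
    (l : ℕ) (b1 : ∀ ω, S ω < l) (G : ℕ → ℝ) :
    ∫ ω, G (S ω) ∂μ = ∑ i ∈ Finset.range l, G i * μ.real (S ⁻¹' {i}) := by
  have := int_two μ S (fun _ => 0) h1 measurable_const l 1 b1 (by simp) (fun i _ => G i)
  rw [this]
  simp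

lemma mix_cov {Ω : Type*} [MeasurableSpace Ω] (μ : Measure Ω)
    [IsProbabilityMeasure μ] (S₁ S₂ : Ω → ℕ) (h1 : Measurable S₁) (h2 : Measurable S₂)
    (l₁ l₂ : ℕ) (b1 : ∀ ω, S₁ ω < l₁) (b2 : ∀ ω, S₂ ω < l₂) (ψ : ℝ)
    (hψ : ∀ i j, |μ.real (S₁ ⁻¹' {i} ∩ S₂ ⁻¹' {j}) - μ.real (S₁ ⁻¹' {i}) * μ.real (S₂ ⁻¹' {j})|
      ≤ ψ * (μ.real (S₁ ⁻¹' {i}) * μ.real (S₂ ⁻¹' {j}))) (G H : ℕ → ℝ) :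
    |∫ ω, G (S₁ ω) * H (S₂ ω) ∂μ - (∫ ω, G (S₁ ω) ∂μ) * ∫ ω, H (S₂ ω) ∂μ| ≤
      ψ * ((∫ ω, |G (S₁ ω)| ∂μ) * ∫ ω, |H (S₂ ω)| ∂μ) := by
  rw [int_two μ S₁ S₂ h1 h2 l₁ l₂ b1 b2 (fun i j => G i * H j), int_one μ S₁ h1 l₁ b1 G,
    int_one μ S₂ h2 l₂ b2 H, int_one μ S₁ h1 l₁ b1 (fun i => |G i|),
    int_one μ S₂ h2 l₂ b2 (fun i => |H i|), Finset.sum_mul_sum, Finset.sum_mul_sum,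
    ← Finset.sum_sub_distrib, Finset.mul_sum]
  refine (Finset.abs_sum_le_sum_abs _ _).trans (Finset.sum_le_sum fun i _ => ?_)
  rw [← Finset.sum_sub_distrib, Finset.mul_sum]
  refine (Finset.abs_sum_le_sum_abs _ _).trans (Finset.sum_le_sum fun j _ => ?_)
  have : G i * H j * μ.real (S₁ ⁻¹' {i} ∩ S₂ ⁻¹' {j}) -
      G i * μ.real (S₁ ⁻¹' {i}) * (H j * μ.real (S₂ ⁻¹' {j})) =
      (G i * H j) * (μ.real (S₁ ⁻¹' {i} ∩ S₂ ⁻¹' {j}) -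
        μ.real (S₁ ⁻¹' {i}) * μ.real (S₂ ⁻¹' {j})) := by ring
  rw [this, abs_mul, abs_mul]
  calc _ ≤ |G i| * |H j| * (ψ * (μ.real (S₁ ⁻¹' {i}) * μ.real (S₂ ⁻¹' {j}))) :=
        mul_le_mul_of_nonneg_left (hψ i j) (by positivity)
    _ = _ := by ring

section cnt
set_option linter.unusedSectionVars false
variable {Ω : Type*} [MeasurableSpace Ω] {T : Ω → Ω} {μ : Measure Ω} {χ : Ω → ℝ}

lemma cnt_add (r l m : ℕ) (x : ℝ) (ω : Ω) :
    cntN T χ r (l + m) x ω = cntN T χ r l x ω + cntN T χ r m x (T^[r * l] ω) := by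
  unfold cntN
  rw [Finset.sum_range_add]
  congr 1
  refine Finset.sum_congr rfl fun i _ => ?_
  rw [← Function.iterate_add_apply, mul_add, add_comm]

lemma cnt_le (r l : ℕ) (x : ℝ) (ω : Ω) : cntN T χ r l x ω ≤ l := by
  unfold cntN
  calc _ ≤ ∑ i ∈ Finset.range l, 1 := Finset.sum_le_sum fun i _ => by split_ifs <;> simp
    _ = l := by simp

lemma cnt_meas_past (r l : ℕ) (hl : 1 ≤ l) (x : ℝ) :
    Measurable[sigmaIcc T χ 1 (r * (l - 1) + 1)] (cntN T χ r l x) := by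
  unfold cntN
  refine Finset.measurable_sum _ fun i hi => ?_
  rw [Finset.mem_range] at hi
  refine Measurable.ite ?_ measurable_const measurable_const
  have hle : MeasurableSpace.comap (fun ω => χ (T^[(r * i + 1) - 1] ω)) inferInstance ≤
      sigmaIcc T χ 1 (r * (l - 1) + 1) := by
    unfold sigmaIcc
    refine le_iSup₂_of_le (r * i + 1) ⟨by omega, ?_⟩ le_rfl
    have : r * i ≤ r * (l - 1) := Nat.mul_le_mul_left _ (by omega)
    omega
  apply hle
  exact ⟨Ioi x, measurableSet_Ioi, by ext ω; simp⟩

lemma cnt_meas_fut (r l m : ℕ) (hl : 1 ≤ l) (x : ℝ) :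
    Measurable[sigmaIci T χ (r * (l - 1) + 1 + r)] (fun ω => cntN T χ r m x (T^[r * l] ω)) := by
  unfold cntN
  refine Finset.measurable_sum _ fun i hi => ?_
  refine Measurable.ite ?_ measurable_const measurable_const
  have hle : MeasurableSpace.comap (fun ω => χ (T^[(r * l + r * i + 1) - 1] ω)) inferInstance ≤
      sigmaIci T χ (r * (l - 1) + 1 + r) := by
    unfold sigmaIci
    refine le_iSup₂_of_le (r * l + r * i + 1) ?_ le_rfl
    obtain ⟨l, rfl⟩ : ∃ k, l = k + 1 := ⟨l - 1, by omega⟩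
    simp only [Set.mem_Ici, Nat.add_sub_cancel]
    have : r * (l + 1) = r * l + r := by ring
    omega
  apply hle
  refine ⟨Ioi x, measurableSet_Ioi, ?_⟩
  ext ω
  simp [← Function.iterate_add_apply, add_comm]

lemma cnt_meas (hT : Measurable T) (hχ : Measurable χ) (r l : ℕ) (x : ℝ) :
    Measurable (cntN T χ r l x) := by
  unfold cntN
  refine Finset.measurable_sum _ fun i _ => ?_
  refine Measurable.ite ?_ measurable_const measurable_const
  exact measurableSet_lt measurable_const (hχ.comp (hT.iterate _))

lemma cnt_integrable [IsProbabilityMeasure μ] (hT : Measurable T) (hχ : Measurable χ)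
    (r l : ℕ) (x : ℝ) (k : ℕ) (G : ℕ → ℝ) :
    Integrable (fun ω => G (cntN T χ r l x (T^[k] ω))) μ := by
  have hm : Measurable (fun ω => G (cntN T χ r l x (T^[k] ω))) :=
    (measurable_from_nat (f := G)).comp ((cnt_meas hT hχ r l x).comp (hT.iterate k))
  refine Integrable.of_bound hm.aestronglyMeasurable (∑ i ∈ Finset.range (l + 1), |G i|)
    (ae_of_all _ fun ω => ?_)
  rw [Real.norm_eq_abs]
  exact Finset.single_le_sum (f := fun i => |G i|) (fun i _ => abs_nonneg _)
    (Finset.mem_range.2 (Nat.lt_succ_of_le (cnt_le r l x _)))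

lemma cnt_shift (hT : MeasurePreserving T μ μ) (hχ : Measurable χ)
    (r l : ℕ) (x : ℝ) (k : ℕ) (G : ℕ → ℝ) :
    ∫ ω, G (cntN T χ r l x (T^[k] ω)) ∂μ = ∫ ω, G (cntN T χ r l x ω) ∂μ := by
  have hk := hT.iterate k
  have hm : Measurable (fun ω => G (cntN T χ r l x ω)) :=
    (measurable_from_nat (f := G)).comp (cnt_meas hT.measurable hχ r l x)
  rw [← integral_map (φ := T^[k]) (f := fun ω => G (cntN T χ r l x ω)) hk.measurable.aemeasurable
    hm.aestronglyMeasurable, hk.map_eq]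

lemma cnt_one (r : ℕ) (x : ℝ) (ω : Ω) :
    cntN T χ r 1 x ω = if x < χ ω then 1 else 0 := by
  unfold cntN
  rw [Finset.sum_range_one]
  rfl

lemma cnt_one_int [IsProbabilityMeasure μ] (hχ : Measurable χ) (r : ℕ) (x : ℝ) (G : ℕ → ℝ)
    (hG : G 0 = 0) :
    ∫ ω, G (cntN T χ r 1 x ω) ∂μ = G 1 * μ.real {ω | x < χ ω} := by
  have : ∀ ω, G (cntN T χ r 1 x ω) = ({ω | x < χ ω}).indicator (fun _ => G 1) ω := by
    intro ω
    rw [cnt_one]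
    by_cases h : x < χ ω <;> simp [h, hG]
  simp_rw [this]
  rw [integral_indicator_const _ (measurableSet_lt measurable_const hχ), smul_eq_mul, mul_comm]

/-- The mixing inequality for consecutive decimated blocks. -/
lemma cnt_mix [IsProbabilityMeasure μ] (hT : MeasurePreserving T μ μ) (hχ : Measurable χ)
    {r : ℕ} {ψ : ℝ} (hψ : ∀ k, 1 ≤ k → ∀ B C : Set Ω, MeasurableSet[sigmaIcc T χ 1 k] B →
      MeasurableSet[sigmaIci T χ (k + r)] C →
      |μ.real (B ∩ C) - μ.real B * μ.real C| ≤ ψ * (μ.real B * μ.real C))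
    (l m : ℕ) (hl : 1 ≤ l) (x : ℝ) (G H : ℕ → ℝ) :
    |∫ ω, G (cntN T χ r l x ω) * H (cntN T χ r m x (T^[r * l] ω)) ∂μ -
      (∫ ω, G (cntN T χ r l x ω) ∂μ) * ∫ ω, H (cntN T χ r m x ω) ∂μ| ≤
      ψ * ((∫ ω, |G (cntN T χ r l x ω)| ∂μ) * ∫ ω, |H (cntN T χ r m x ω)| ∂μ) := by
  have := mix_cov μ (cntN T χ r l x) (fun ω => cntN T χ r m x (T^[r * l] ω))
    (cnt_meas hT.measurable hχ r l x)
    ((cnt_meas hT.measurable hχ r m x).comp (hT.measurable.iterate _)) (l + 1) (m + 1)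
    (fun ω => Nat.lt_succ_of_le (cnt_le _ _ _ _)) (fun ω => Nat.lt_succ_of_le (cnt_le _ _ _ _)) ψ
    (fun i j => hψ _ (by omega) _ _ (cnt_meas_past r l hl x (measurableSet_singleton i))
      (cnt_meas_fut r l m hl x (measurableSet_singleton j))) G H
  rw [cnt_shift hT hχ r m x _ H, cnt_shift hT hχ r m x _ (fun i => |H i|)] at this
  exact this

end cnt

section moments
set_option linter.unusedSectionVars false
variable {Ω : Type*} [MeasurableSpace Ω] {T : Ω → Ω} {μ : Measure Ω} {χ : Ω → ℝ}

lemma int_aux1 {f g h : Ω → ℝ} (c : ℝ) (hf : Integrable f μ) (hg : Integrable g μ)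
    (hh : Integrable h μ) :
    ∫ ω, (f ω + g ω + c * h ω) ∂μ = ∫ ω, f ω ∂μ + ∫ ω, g ω ∂μ + c * ∫ ω, h ω ∂μ := by
  have h1 : Integrable (fun ω => f ω + g ω) μ := hf.add hg
  rw [integral_add h1 (hh.const_mul c), integral_add hf hg, integral_const_mul]

lemma int_aux2 [IsProbabilityMeasure μ] {f g : Ω → ℝ} (c d : ℝ) (hf : Integrable f μ)
    (hg : Integrable g μ) :
    ∫ ω, (f ω - c * g ω + d) ∂μ = ∫ ω, f ω ∂μ - c * ∫ ω, g ω ∂μ + d := by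
  have h1 : Integrable (fun ω => f ω - c * g ω) μ := hf.sub (hg.const_mul c)
  rw [integral_add h1 (integrable_const _), integral_sub hf (hg.const_mul c), integral_const_mul]
  simp

lemma cnt_integrable' [IsProbabilityMeasure μ] (hT : Measurable T) (hχ : Measurable χ)
    (r l : ℕ) (x : ℝ) (G : ℕ → ℝ) :
    Integrable (fun ω => G (cntN T χ r l x ω)) μ :=
  cnt_integrable hT hχ r l x 0 G

lemma cnt_integrable2 [IsProbabilityMeasure μ] (hT : Measurable T) (hχ : Measurable χ)
    (r l m : ℕ) (x : ℝ) (k : ℕ) (G H : ℕ → ℝ) :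
    Integrable (fun ω => G (cntN T χ r l x ω) * H (cntN T χ r m x (T^[k] ω))) μ := by
  have hm : Measurable (fun ω => G (cntN T χ r l x ω)) :=
    (measurable_from_nat (f := G)).comp (cnt_meas hT hχ r l x)
  refine Integrable.bdd_mul (c := ∑ i ∈ Finset.range (l + 1), |G i|)
    (cnt_integrable hT hχ r m x k H) hm.aestronglyMeasurable (ae_of_all _ fun ω => ?_)
  rw [Real.norm_eq_abs]
  exact Finset.single_le_sum (f := fun i => |G i|) (fun i _ => abs_nonneg _)
    (Finset.mem_range.2 (Nat.lt_succ_of_le (cnt_le r l x _)))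

lemma cnt_mean [IsProbabilityMeasure μ] (hT : MeasurePreserving T μ μ) (hχ : Measurable χ)
    (r l : ℕ) (x : ℝ) :
    ∫ ω, (cntN T χ r l x ω : ℝ) ∂μ = l * μ.real {ω | x < χ ω} := by
  induction l with
  | zero => simp [cntN]
  | succ l ih =>
    have e : ∀ ω, (cntN T χ r (l + 1) x ω : ℝ) =
        (cntN T χ r l x ω : ℝ) + (cntN T χ r 1 x (T^[r * l] ω) : ℝ) := fun ω => by
      rw [cnt_add]; push_cast; rfl
    simp_rw [e]
    rw [integral_add (cnt_integrable' hT.measurable hχ r l x (fun i => (i : ℝ)))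
      (cnt_integrable hT.measurable hχ r 1 x _ (fun i => (i : ℝ))), ih,
      cnt_shift hT hχ r 1 x _ (fun i => (i : ℝ)), cnt_one_int hχ r x (fun i => (i : ℝ)) (by simp)]
    push_cast; ring

variable {r : ℕ} {ψ : ℝ}

lemma cnt_mul_le [IsProbabilityMeasure μ] (hT : MeasurePreserving T μ μ) (hχ : Measurable χ)
    (hψ : ∀ k, 1 ≤ k → ∀ B C : Set Ω, MeasurableSet[sigmaIcc T χ 1 k] B →
      MeasurableSet[sigmaIci T χ (k + r)] C →
      |μ.real (B ∩ C) - μ.real B * μ.real C| ≤ ψ * (μ.real B * μ.real C))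
    (hψ1 : ψ < 1) (l : ℕ) (hl : 1 ≤ l) (x : ℝ) (G : ℕ → ℝ) (hG : ∀ i, 0 ≤ G i) :
    ∫ ω, G (cntN T χ r l x ω) * (cntN T χ r 1 x (T^[r * l] ω) : ℝ) ∂μ ≤
      2 * μ.real {ω | x < χ ω} * ∫ ω, G (cntN T χ r l x ω) ∂μ := by
  have h := cnt_mix hT hχ hψ l 1 hl x G (fun i => (i : ℝ))
  rw [cnt_one_int hχ r x (fun i => |(i : ℝ)|) (by simp),
    cnt_one_int hχ r x (fun i => (i : ℝ)) (by simp)] at h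
  simp only [abs_of_nonneg (hG _)] at h
  have h' := (abs_le.1 h).2
  have h0 : 0 ≤ ∫ ω, G (cntN T χ r l x ω) ∂μ := integral_nonneg fun ω => hG _
  have hp : 0 ≤ μ.real {ω | x < χ ω} := measureReal_nonneg
  have := mul_nonneg h0 hp
  simp only [Nat.cast_one, abs_one, one_mul] at h'
  nlinarith

lemma cnt_sq [IsProbabilityMeasure μ] (hT : MeasurePreserving T μ μ) (hχ : Measurable χ)
    (hψ : ∀ k, 1 ≤ k → ∀ B C : Set Ω, MeasurableSet[sigmaIcc T χ 1 k] B →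
      MeasurableSet[sigmaIci T χ (k + r)] C →
      |μ.real (B ∩ C) - μ.real B * μ.real C| ≤ ψ * (μ.real B * μ.real C))
    (hψ1 : ψ < 1) (l : ℕ) (x : ℝ) :
    ∫ ω, (cntN T χ r l x ω : ℝ) ^ 2 ∂μ ≤
      l * μ.real {ω | x < χ ω} + 2 * (l * μ.real {ω | x < χ ω}) ^ 2 := by
  induction l with
  | zero => simp [cntN]
  | succ l ih =>
    set p := μ.real {ω | x < χ ω} with hp
    have hp0 : 0 ≤ p := measureReal_nonneg
    rcases Nat.eq_zero_or_pos l with rfl | hl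
    · rw [zero_add, cnt_one_int hχ r x (fun i => (i : ℝ) ^ 2) (by simp), ← hp]
      simp; positivity
    have e : ∀ ω, (cntN T χ r (l + 1) x ω : ℝ) ^ 2 =
        ((cntN T χ r l x ω : ℝ) ^ 2 + (cntN T χ r 1 x (T^[r * l] ω) : ℝ) ^ 2) +
        2 * ((cntN T χ r l x ω : ℝ) * (cntN T χ r 1 x (T^[r * l] ω) : ℝ)) := fun ω => by
      rw [cnt_add]; push_cast; ring
    simp_rw [e]
    have i1 := cnt_integrable' (μ := μ) hT.measurable hχ r l x (fun i => (i : ℝ) ^ 2)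
    have i2 := cnt_integrable (μ := μ) hT.measurable hχ r 1 x (r * l) (fun i => (i : ℝ) ^ 2)
    have i3 := cnt_integrable2 (μ := μ) hT.measurable hχ r l 1 x (r * l) (fun i => (i : ℝ))
      (fun i => (i : ℝ))
    rw [int_aux1 2 i1 i2 i3,
      cnt_shift hT hχ r 1 x _ (fun i => (i : ℝ) ^ 2),
      cnt_one_int hχ r x (fun i => (i : ℝ) ^ 2) (by simp), ← hp]
    have h3 := cnt_mul_le hT hχ hψ hψ1 l hl x (fun i => (i : ℝ)) (fun i => by positivity)
    rw [cnt_mean hT hχ, ← hp] at h3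
    push_cast
    nlinarith [mul_nonneg hp0 hp0]

lemma cnt_var_double [IsProbabilityMeasure μ] (hT : MeasurePreserving T μ μ) (hχ : Measurable χ)
    (hψ : ∀ k, 1 ≤ k → ∀ B C : Set Ω, MeasurableSet[sigmaIcc T χ 1 k] B →
      MeasurableSet[sigmaIci T χ (k + r)] C →
      |μ.real (B ∩ C) - μ.real B * μ.real C| ≤ ψ * (μ.real B * μ.real C))
    (hψ0 : 0 ≤ ψ) (l : ℕ) (hl : 1 ≤ l) (x : ℝ) :
    ∫ ω, ((cntN T χ r (2 * l) x ω : ℝ) - ((2 * l : ℕ) : ℝ) * μ.real {ω | x < χ ω}) ^ 2 ∂μ ≤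
      2 * (1 + ψ) * ∫ ω, ((cntN T χ r l x ω : ℝ) - l * μ.real {ω | x < χ ω}) ^ 2 ∂μ := by
  set p := μ.real {ω | x < χ ω} with hp
  set G : ℕ → ℝ := fun i => (i : ℝ) - l * p with hG
  have e : ∀ ω, ((cntN T χ r (2 * l) x ω : ℝ) - ((2 * l : ℕ) : ℝ) * p) ^ 2 =
        (G (cntN T χ r l x ω) ^ 2 + G (cntN T χ r l x (T^[r * l] ω)) ^ 2) +
        2 * (G (cntN T χ r l x ω) * G (cntN T χ r l x (T^[r * l] ω))) := fun ω => by
    rw [two_mul l, cnt_add]; simp only [hG]; push_cast; ring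
  simp_rw [e]
  have i1 := cnt_integrable' (μ := μ) hT.measurable hχ r l x (fun i => G i ^ 2)
  have i2 := cnt_integrable (μ := μ) hT.measurable hχ r l x (r * l) (fun i => G i ^ 2)
  have i3 := cnt_integrable2 (μ := μ) hT.measurable hχ r l l x (r * l) G G
  rw [int_aux1 2 i1 i2 i3,
      cnt_shift hT hχ r l x _ (fun i => G i ^ 2)]
  have h3 := cnt_mix hT hχ hψ l l hl x G G
  have hz : ∫ ω, G (cntN T χ r l x ω) ∂μ = 0 := by
    simp only [hG]
    rw [integral_sub (cnt_integrable' hT.measurable hχ r l x (fun i => (i : ℝ)))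
      (integrable_const _), cnt_mean hT hχ]
    simp [hp]
  rw [hz] at h3
  have h4 := (abs_le.1 h3).2
  have hcs : (∫ ω, |G (cntN T χ r l x ω)| ∂μ) * (∫ ω, |G (cntN T χ r l x ω)| ∂μ) ≤
      ∫ ω, G (cntN T χ r l x ω) ^ 2 ∂μ := by
    set a := ∫ ω, |G (cntN T χ r l x ω)| ∂μ with ha
    have hh : 0 ≤ ∫ ω, (|G (cntN T χ r l x ω)| - a) ^ 2 ∂μ := integral_nonneg fun ω => sq_nonneg _
    have e2 : ∀ ω, (|G (cntN T χ r l x ω)| - a) ^ 2 =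
      (G (cntN T χ r l x ω) ^ 2 - 2 * a * |G (cntN T χ r l x ω)|) + a ^ 2 := fun ω => by
        rw [sub_sq, sq_abs]; ring
    simp_rw [e2] at hh
    have i4 := cnt_integrable' (μ := μ) hT.measurable hχ r l x (fun i => |G i|)
    rw [int_aux2 _ _ i1 i4, ← ha] at hh
    nlinarith
  have := mul_le_mul_of_nonneg_left hcs hψ0
  have e3 : ∀ ω, ((cntN T χ r l x ω : ℝ) - l * p) = G (cntN T χ r l x ω) := fun ω => rfl
  simp_rw [e3]
  linarith

lemma cnt_var [IsProbabilityMeasure μ] (hT : MeasurePreserving T μ μ) (hχ : Measurable χ)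
    (hψ : ∀ k, 1 ≤ k → ∀ B C : Set Ω, MeasurableSet[sigmaIcc T χ 1 k] B →
      MeasurableSet[sigmaIci T χ (k + r)] C →
      |μ.real (B ∩ C) - μ.real B * μ.real C| ≤ ψ * (μ.real B * μ.real C))
    (hψ0 : 0 ≤ ψ) (hψ1 : ψ < 1) (q : ℕ) (hq : 1 ≤ q) (x : ℝ)
    (hqp : 1 ≤ q * μ.real {ω | x < χ ω}) (K : ℕ) :
    ∫ ω, ((cntN T χ r (2 ^ K * q) x ω : ℝ) -
      ((2 ^ K * q : ℕ) : ℝ) * μ.real {ω | x < χ ω}) ^ 2 ∂μ ≤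
      3 * ((1 + ψ) / 2) ^ K * (((2 ^ K * q : ℕ) : ℝ) * μ.real {ω | x < χ ω}) ^ 2 := by
  set p := μ.real {ω | x < χ ω} with hp
  have hp0 : 0 ≤ p := measureReal_nonneg
  induction K with
  | zero =>
    simp only [pow_zero, one_mul, mul_one]
    have i1 := cnt_integrable' (μ := μ) hT.measurable hχ r q x (fun i => (i : ℝ) ^ 2)
    have i4 := cnt_integrable' (μ := μ) hT.measurable hχ r q x (fun i => (i : ℝ))
    have e2 : ∀ ω, ((cntN T χ r q x ω : ℝ) - q * p) ^ 2 =
      ((cntN T χ r q x ω : ℝ) ^ 2 - 2 * (q * p) * (cntN T χ r q x ω : ℝ)) + (q * p) ^ 2 :=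
      fun ω => by ring
    simp_rw [e2]
    rw [int_aux2 _ _ i1 i4, cnt_mean hT hχ, ← hp]
    have := cnt_sq hT hχ hψ hψ1 q x
    rw [← hp] at this
    simp
    nlinarith
  | succ K ih =>
    have h := cnt_var_double hT hχ hψ hψ0 (2 ^ K * q) (Nat.mul_pos (by positivity) hq) x
    rw [← hp] at h
    have e : 2 ^ (K + 1) * q = 2 * (2 ^ K * q) := by ring
    rw [e]
    refine h.trans ((mul_le_mul_of_nonneg_left ih (by positivity)).trans (le_of_eq ?_))
    push_cast
    ring

lemma cnt_exp [IsProbabilityMeasure μ] (hT : MeasurePreserving T μ μ) (hχ : Measurable χ)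
    (hψ : ∀ k, 1 ≤ k → ∀ B C : Set Ω, MeasurableSet[sigmaIcc T χ 1 k] B →
      MeasurableSet[sigmaIci T χ (k + r)] C →
      |μ.real (B ∩ C) - μ.real B * μ.real C| ≤ ψ * (μ.real B * μ.real C))
    (hψ1 : ψ < 1) (l : ℕ) (x : ℝ) (a : ℝ) (ha : 0 ≤ a) :
    ∫ ω, (1 + a) ^ (cntN T χ r l x ω) ∂μ ≤ (1 + 2 * a * μ.real {ω | x < χ ω}) ^ l := by
  induction l with
  | zero => simp [cntN]
  | succ l ih =>
    set p := μ.real {ω | x < χ ω} with hp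
    have hp0 : 0 ≤ p := measureReal_nonneg
    have e : ∀ ω, (1 + a) ^ (cntN T χ r (l + 1) x ω) = (1 + a) ^ (cntN T χ r l x ω) +
        a * ((1 + a) ^ (cntN T χ r l x ω) * (cntN T χ r 1 x (T^[r * l] ω) : ℝ)) := fun ω => by
      rw [cnt_add, pow_add, cnt_one]
      split_ifs <;> simp
      ring
    simp_rw [e]
    have i1 := cnt_integrable' (μ := μ) hT.measurable hχ r l x (fun i => (1 + a) ^ i)
    have i3 := cnt_integrable2 (μ := μ) hT.measurable hχ r l 1 x (r * l) (fun i => (1 + a) ^ i)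
      (fun i => (i : ℝ))
    rw [integral_add i1 (i3.const_mul a), integral_const_mul]
    rcases Nat.eq_zero_or_pos l with rfl | hl
    · simp only [cntN, Finset.range_zero, Finset.sum_empty, pow_zero, one_mul]
      have := cnt_one_int (T := T) (μ := μ) hχ r x (fun i => (i : ℝ)) (by simp)
      simp only [cntN] at this
      simp only [mul_zero, Function.iterate_zero, id_eq] at this ⊢
      rw [this]
      simp
      nlinarith [mul_nonneg ha hp0]
    · have h3 := cnt_mul_le hT hχ hψ hψ1 l hl x (fun i => (1 + a) ^ i) (fun i => by positivity)
      rw [← hp] at h3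
      have h4 := mul_le_mul_of_nonneg_left h3 ha
      have h5 := mul_le_mul_of_nonneg_left ih (by positivity : 0 ≤ 1 + 2 * a * p)
      rw [pow_succ]
      linarith

/-- Bulk estimate. -/
lemma cnt_bulk [IsProbabilityMeasure μ] (hT : MeasurePreserving T μ μ) (hχ : Measurable χ)
    (hψ : ∀ k, 1 ≤ k → ∀ B C : Set Ω, MeasurableSet[sigmaIcc T χ 1 k] B →
      MeasurableSet[sigmaIci T χ (k + r)] C →
      |μ.real (B ∩ C) - μ.real B * μ.real C| ≤ ψ * (μ.real B * μ.real C))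
    (hψ0 : 0 ≤ ψ) (hψ1 : ψ < 1) (q : ℕ) (hq : 1 ≤ q) (x : ℝ)
    (hqp : 1 ≤ q * μ.real {ω | x < χ ω}) (K : ℕ) (η : ℝ) (hη : 0 ≤ η)
    (hK : 3 * ((1 + ψ) / 2) ^ K ≤ η ^ 2) (c : ℝ) :
    ∫ ω, max ((cntN T χ r (2 ^ K * q) x ω : ℝ) - c) 0 ∂μ ≤
      max (((2 ^ K * q : ℕ) : ℝ) * μ.real {ω | x < χ ω} - c) 0 +
      η * (((2 ^ K * q : ℕ) : ℝ) * μ.real {ω | x < χ ω}) := by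
  have hv := cnt_var hT hχ hψ hψ0 hψ1 q hq x hqp K
  set m := ((2 ^ K * q : ℕ) : ℝ) * μ.real {ω | x < χ ω} with hm
  have hm0 : 0 ≤ m := mul_nonneg (by positivity) measureReal_nonneg
  set M := 2 ^ K * q
  have i1 := cnt_integrable' (μ := μ) hT.measurable hχ r M x (fun i => max ((i : ℝ) - c) 0)
  have i2 := cnt_integrable' (μ := μ) hT.measurable hχ r M x (fun i => |(i : ℝ) - m|)
  have i3 := cnt_integrable' (μ := μ) hT.measurable hχ r M x (fun i => ((i : ℝ) - m) ^ 2)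
  have hcs : (∫ ω, |(cntN T χ r M x ω : ℝ) - m| ∂μ) ^ 2 ≤
      ∫ ω, ((cntN T χ r M x ω : ℝ) - m) ^ 2 ∂μ := by
    set a := ∫ ω, |(cntN T χ r M x ω : ℝ) - m| ∂μ with ha
    have hh : 0 ≤ ∫ ω, (|(cntN T χ r M x ω : ℝ) - m| - a) ^ 2 ∂μ :=
      integral_nonneg fun ω => sq_nonneg _
    have e2 : ∀ ω, (|(cntN T χ r M x ω : ℝ) - m| - a) ^ 2 =
      (((cntN T χ r M x ω : ℝ) - m) ^ 2 - 2 * a * |(cntN T χ r M x ω : ℝ) - m|) + a ^ 2 :=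
        fun ω => by rw [sub_sq, sq_abs]; ring
    simp_rw [e2] at hh
    rw [int_aux2 _ _ i3 i2, ← ha] at hh
    nlinarith
  have h1 : (∫ ω, |(cntN T χ r M x ω : ℝ) - m| ∂μ) ≤ η * m := by
    refine abs_le_of_sq_le_sq' (hcs.trans (hv.trans ?_)) (by positivity) |>.2
    rw [mul_pow η]
    exact mul_le_mul_of_nonneg_right hK (sq_nonneg m)
  calc _ ≤ ∫ ω, (max (m - c) 0 + |(cntN T χ r M x ω : ℝ) - m|) ∂μ := by
        refine integral_mono i1 ((integrable_const _).add i2) fun ω => ?_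
        have := le_abs_self ((cntN T χ r M x ω : ℝ) - m)
        have := abs_nonneg ((cntN T χ r M x ω : ℝ) - m)
        have := le_max_left (m - c) 0
        have := le_max_right (m - c) 0
        simp only
        refine max_le ?_ ?_ <;> linarith
    _ = max (m - c) 0 + ∫ ω, |(cntN T χ r M x ω : ℝ) - m| ∂μ := by
        rw [integral_add (integrable_const _) i2]; simp
    _ ≤ _ := by linarith

/-- Tail estimate. -/
lemma cnt_tail [IsProbabilityMeasure μ] (hT : MeasurePreserving T μ μ) (hχ : Measurable χ)
    (hψ : ∀ k, 1 ≤ k → ∀ B C : Set Ω, MeasurableSet[sigmaIcc T χ 1 k] B →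
      MeasurableSet[sigmaIci T χ (k + r)] C →
      |μ.real (B ∩ C) - μ.real B * μ.real C| ≤ ψ * (μ.real B * μ.real C))
    (hψ1 : ψ < 1) (M : ℕ) (x : ℝ) (c : ℝ) (u : ℝ) (hu : 0 < u) (hu1 : u ≤ 1)
    (hmu : Real.exp 2 * (M * μ.real {ω | x < χ ω}) ≤ u * c) :
    ∫ ω, max ((cntN T χ r M x ω : ℝ) - c) 0 ∂μ ≤ u ^ c := by
  set p := μ.real {ω | x < χ ω} with hp
  have hp0 : 0 ≤ p := measureReal_nonneg
  -- s = 2 - log u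
  set s := 2 - Real.log u with hs
  have hlog : Real.log u ≤ 0 := Real.log_nonpos hu.le hu1
  have hes : Real.exp s = Real.exp 2 / u := by rw [hs, Real.exp_sub, Real.exp_log hu]
  have h1 : (1 : ℝ) ≤ Real.exp s := Real.one_le_exp (by linarith)
  have hexp := cnt_exp hT hχ hψ hψ1 M x (Real.exp s - 1) (by linarith)
  rw [← hp] at hexp
  have hb : (1 + 2 * (Real.exp s - 1) * p) ^ M ≤ Real.exp (2 * c) := by
    calc (1 + 2 * (Real.exp s - 1) * p) ^ M ≤ (Real.exp (2 * Real.exp s * p)) ^ M := by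
          refine pow_le_pow_left₀ ?_ ?_ _
          · have : 0 ≤ (Real.exp s - 1) * p := mul_nonneg (by linarith) hp0
            linarith
          · have := Real.add_one_le_exp (2 * Real.exp s * p)
            linarith
      _ = Real.exp (2 * (Real.exp s * (M * p))) := by rw [← Real.exp_nat_mul]; ring_nf
      _ ≤ _ := by
          refine Real.exp_le_exp.2 (mul_le_mul_of_nonneg_left ?_ (by norm_num))
          rw [hes, div_mul_eq_mul_div, div_le_iff₀ hu]
          linarith
  have i1 := cnt_integrable' (μ := μ) hT.measurable hχ r M x (fun i => max ((i : ℝ) - c) 0)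
  have i2 := cnt_integrable' (μ := μ) hT.measurable hχ r M x
    (fun i => (1 + (Real.exp s - 1)) ^ i)
  calc _ ≤ ∫ ω, Real.exp (-(s * c)) * (1 + (Real.exp s - 1)) ^ (cntN T χ r M x ω) ∂μ := by
        refine integral_mono i1 (i2.const_mul _) fun ω => ?_
        have e : Real.exp (-(s * c)) * (1 + (Real.exp s - 1)) ^ (cntN T χ r M x ω) =
            Real.exp (s * ((cntN T χ r M x ω : ℝ) - c)) := by
          rw [add_sub_cancel, ← Real.exp_nat_mul, ← Real.exp_add]; ring_nf
        simp only
        rw [e]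
        set y := (cntN T χ r M x ω : ℝ) - c
        refine max_le ?_ (Real.exp_pos _).le
        rcases le_total y 0 with hy | hy
        · exact hy.trans (Real.exp_pos _).le
        · have := Real.add_one_le_exp (s * y)
          nlinarith
    _ = Real.exp (-(s * c)) * ∫ ω, (1 + (Real.exp s - 1)) ^ (cntN T χ r M x ω) ∂μ :=
        integral_const_mul _ _
    _ ≤ Real.exp (-(s * c)) * Real.exp (2 * c) :=
        mul_le_mul_of_nonneg_left (hexp.trans hb) (Real.exp_pos _).le
    _ = u ^ c := by
        rw [← Real.exp_add, Real.rpow_def_of_pos hu, hs]; ring_nf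

/-- Splitting the full count into `r` decimated counts. -/
lemma cnt_split (r M n : ℕ) (hn : n ≤ r * M) (x : ℝ) (ω : Ω) :
    cntN T χ 1 n x ω ≤ ∑ j ∈ Finset.range r, cntN T χ r M x (T^[j] ω) := by
  have h1 : cntN T χ 1 n x ω ≤ cntN T χ 1 (r * M) x ω := by
    unfold cntN
    exact Finset.sum_le_sum_of_subset (Finset.range_subset_range.2 hn)
  refine h1.trans (le_of_eq ?_)
  unfold cntN
  rw [Finset.sum_comm, mul_comm r M]
  clear h1 hn
  induction M with
  | zero => simp
  | succ M ih =>
    rw [Nat.succ_mul, Finset.sum_range_add, ih, Finset.sum_range_succ]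
    congr 1
    refine Finset.sum_congr rfl fun j _ => ?_
    rw [one_mul, ← Function.iterate_add_apply, mul_comm M r]

lemma cnt_full [IsProbabilityMeasure μ] (hT : MeasurePreserving T μ μ) (hχ : Measurable χ)
    (hr : 1 ≤ r) (M n : ℕ) (hn : n ≤ r * M) (b : ℕ) (x : ℝ) :
    ∫⁻ ω, ((cntN T χ 1 n x ω - b : ℕ) : ℝ≥0∞) ∂μ ≤
      ENNReal.ofReal (r * ∫ ω, max ((cntN T χ r M x ω : ℝ) - b / r) 0 ∂μ) := by
  have hr' : (0 : ℝ) < r := by exact_mod_cast hr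
  have i1 : ∀ j, Integrable (fun ω => max ((cntN T χ r M x (T^[j] ω) : ℝ) - b / r) 0) μ :=
    fun j => cnt_integrable hT.measurable hχ r M x j (fun i => max ((i : ℝ) - b / r) 0)
  have e : (r * ∫ ω, max ((cntN T χ r M x ω : ℝ) - b / r) 0 ∂μ) =
      ∫ ω, ∑ j ∈ Finset.range r, max ((cntN T χ r M x (T^[j] ω) : ℝ) - b / r) 0 ∂μ := by
    rw [integral_finsetSum _ fun j _ => i1 j]
    rw [Finset.sum_congr rfl fun j _ =>
      cnt_shift hT hχ r M x j (fun i => max ((i : ℝ) - b / r) 0)]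
    simp
  rw [e, ofReal_integral_eq_lintegral_ofReal (integrable_finsetSum _ fun j _ => i1 j)
    (ae_of_all _ fun ω => Finset.sum_nonneg fun j _ => le_max_right _ _)]
  refine lintegral_mono fun ω => ?_
  rw [← ENNReal.ofReal_natCast]
  refine ENNReal.ofReal_le_ofReal ?_
  have h := cnt_split (T := T) (χ := χ) r M n hn x ω
  have h0 : 0 ≤ ∑ j ∈ Finset.range r, max ((cntN T χ r M x (T^[j] ω) : ℝ) - b / r) 0 :=
    Finset.sum_nonneg fun j _ => le_max_right _ _
  rcases le_total (cntN T χ 1 n x ω) b with hb | hb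
  · rw [Nat.sub_eq_zero_of_le hb]; simpa using h0
  · rw [Nat.cast_sub hb]
    have h2 : (cntN T χ 1 n x ω : ℝ) ≤ ∑ j ∈ Finset.range r, (cntN T χ r M x (T^[j] ω) : ℝ) := by
      exact_mod_cast h
    have h3 : ∑ j ∈ Finset.range r, ((cntN T χ r M x (T^[j] ω) : ℝ) - b / r) ≤
        ∑ j ∈ Finset.range r, max ((cntN T χ r M x (T^[j] ω) : ℝ) - b / r) 0 :=
      Finset.sum_le_sum fun j _ => le_max_left _ _
    rw [Finset.sum_sub_distrib] at h3
    simp at h3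
    rw [mul_div_cancel₀ _ hr'.ne'] at h3
    linarith

end moments

lemma potter (p : ℝ → ℝ) (hanti : Antitone p) (hpos : ∀ x, 0 < x → 0 < p x) (α : ℝ) (h0 : 0 < α)
    (h1 : α < 1) (hlim : Tendsto (fun x => p (2 * x) / p x) atTop (𝓝 ((2 : ℝ) ^ (-α)))) :
    ∃ x0 : ℝ, 1 ≤ x0 ∧ (∀ x, x0 ≤ x → p (2 * x) ≤ (2 : ℝ) ^ (-(α / 2)) * p x) ∧
      (∀ y x, x0 ≤ y → y ≤ x → p x ≤ 2 * p y * (y / x) ^ (α / 2)) ∧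
      (∀ y x, x0 ≤ y → y ≤ x → p y ≤ 2 * p x * (x / y) ^ ((1 + α) / 2)) := by
  set β := α / 2 with hβ
  set β' := (1 + α) / 2 with hβ'
  have hβ0 : 0 < β := by positivity
  have hβ1 : β ≤ 1 := by rw [hβ]; linarith
  have hβ'0 : 0 < β' := by positivity
  have hβ'1 : β' ≤ 1 := by rw [hβ']; linarith
  have e1 : ∀ᶠ x in atTop, p (2 * x) / p x < (2 : ℝ) ^ (-β) :=
    hlim.eventually_lt_const (Real.rpow_lt_rpow_of_exponent_lt (by norm_num) (by rw [hβ]; linarith))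
  have e2 : ∀ᶠ x in atTop, (2 : ℝ) ^ (-β') < p (2 * x) / p x :=
    hlim.eventually_const_lt
      (Real.rpow_lt_rpow_of_exponent_lt (by norm_num) (by rw [hβ']; linarith))
  obtain ⟨x1, hx1⟩ := (e1.and e2).exists_forall_of_atTop
  set x0 := max x1 1 with hx0
  have hx01 : 1 ≤ x0 := le_max_right _ _
  have a1 : ∀ x, x0 ≤ x → p (2 * x) ≤ (2 : ℝ) ^ (-β) * p x := by
    intro x hx
    have hp := hpos x (by linarith)
    have := (hx1 x ((le_max_left _ _).trans hx)).1
    rw [div_lt_iff₀ hp] at this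
    exact this.le
  have a2 : ∀ x, x0 ≤ x → (2 : ℝ) ^ (-β') * p x ≤ p (2 * x) := by
    intro x hx
    have hp := hpos x (by linarith)
    have := (hx1 x ((le_max_left _ _).trans hx)).2
    rw [lt_div_iff₀ hp] at this
    exact this.le
  have ge : ∀ (j : ℕ) y, x0 ≤ y → x0 ≤ 2 ^ j * y := by
    intro j y hy
    have : (1 : ℝ) ≤ 2 ^ j := one_le_pow₀ (by norm_num)
    nlinarith
  have b1 : ∀ (j : ℕ) y, x0 ≤ y → p (2 ^ j * y) ≤ ((2 : ℝ) ^ j) ^ (-β) * p y := by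
    intro j y hy
    induction j with
    | zero => simp
    | succ j ih =>
      have := a1 _ (ge j y hy)
      rw [pow_succ', mul_assoc, Real.mul_rpow (by norm_num) (by positivity), mul_assoc]
      exact this.trans (mul_le_mul_of_nonneg_left ih (by positivity))
  have b2 : ∀ (j : ℕ) y, x0 ≤ y → ((2 : ℝ) ^ j) ^ (-β') * p y ≤ p (2 ^ j * y) := by
    intro j y hy
    induction j with
    | zero => simp
    | succ j ih =>
      have := a2 _ (ge j y hy)
      rw [pow_succ', mul_assoc, Real.mul_rpow (by norm_num) (by positivity), mul_assoc]
      exact (mul_le_mul_of_nonneg_left ih (by positivity)).trans this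
  have two_le : ∀ γ : ℝ, γ ≤ 1 → (2 : ℝ) ^ γ ≤ 2 := fun γ hγ => by
    simpa using Real.rpow_le_rpow_of_exponent_le (by norm_num : (1 : ℝ) ≤ 2) hγ
  refine ⟨x0, hx01, a1, ?_, ?_⟩
  · intro y x hy hyx
    have hy0 : 0 < y := by linarith
    have hx0' : 0 < x := by linarith
    obtain ⟨j, hj1, hj2⟩ := exists_nat_pow_near (x := x / y) (y := 2) ((one_le_div hy0).2 hyx)
      (by norm_num)
    have hpy := hpos y hy0
    rw [le_div_iff₀ hy0] at hj1
    calc p x ≤ p (2 ^ j * y) := hanti hj1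
      _ ≤ ((2 : ℝ) ^ j) ^ (-β) * p y := b1 j y hy
      _ ≤ (2 * (y / x) ^ β) * p y := by
          refine mul_le_mul_of_nonneg_right ?_ hpy.le
          have e : ((2 : ℝ) ^ j) ^ (-β) = 2 ^ β * ((2 : ℝ) ^ (j + 1)) ^ (-β) := by
            rw [pow_succ', Real.mul_rpow (by norm_num) (by positivity), ← mul_assoc,
              ← Real.rpow_add (by norm_num)]
            simp
          rw [e]
          have e' : (y / x) ^ β = (x / y) ^ (-β) := by
            rw [Real.rpow_neg (by positivity), ← Real.inv_rpow (by positivity), inv_div]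
          rw [e']
          refine mul_le_mul (two_le _ hβ1) ?_ (by positivity) (by norm_num)
          exact Real.rpow_le_rpow_of_nonpos (by positivity) hj2.le (by linarith)
      _ = _ := by ring
  · intro y x hy hyx
    have hy0 : 0 < y := by linarith
    have hx0' : 0 < x := by linarith
    obtain ⟨j, hj1, hj2⟩ := exists_nat_pow_near (x := x / y) (y := 2) ((one_le_div hy0).2 hyx)
      (by norm_num)
    have hpx := hpos x hx0'
    have hj3 : x ≤ 2 ^ (j + 1) * y := by
      rw [div_lt_iff₀ hy0] at hj2; exact hj2.le
    have h := (b2 (j + 1) y hy).trans (hanti hj3)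
    rw [Real.rpow_neg (by positivity), inv_mul_le_iff₀ (by positivity)] at h
    refine h.trans ?_
    have : ((2 : ℝ) ^ (j + 1)) ^ β' ≤ 2 * (x / y) ^ β' := by
      rw [pow_succ', Real.mul_rpow (by norm_num) (by positivity)]
      refine mul_le_mul (two_le _ hβ'1) ?_ (by positivity) (by norm_num)
      exact Real.rpow_le_rpow (by positivity) hj1 hβ'0.le
    calc _ ≤ 2 * (x / y) ^ β' * p x := mul_le_mul_of_nonneg_right this hpx.le
      _ = _ := by ring

lemma lint_pow_low (Y γ : ℝ) (hY : 0 < Y) (hγ : γ < 1) :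
    ∫⁻ x in Ioc 0 Y, ENNReal.ofReal ((Y / x) ^ γ) = ENNReal.ofReal (Y / (1 - γ)) := by
  have hi : IntervalIntegrable (fun x : ℝ => x ^ (-γ)) volume 0 Y :=
    intervalIntegral.intervalIntegrable_rpow' (by linarith)
  have hi' : IntegrableOn (fun x : ℝ => x ^ (-γ)) (Ioc 0 Y) :=
    (intervalIntegrable_iff_integrableOn_Ioc_of_le hY.le).1 hi
  have e : ∀ x ∈ Ioc 0 Y, ENNReal.ofReal ((Y / x) ^ γ) = ENNReal.ofReal (Y ^ γ * x ^ (-γ)) := by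
    intro x hx
    rw [Real.div_rpow hY.le hx.1.le, Real.rpow_neg hx.1.le]
    rfl
  rw [setLIntegral_congr_fun measurableSet_Ioc e,
    ← ofReal_integral_eq_lintegral_ofReal (hi'.const_mul _)]
  · congr 1
    rw [integral_const_mul, ← intervalIntegral.integral_of_le hY.le,
      integral_rpow (Or.inl (by linarith)), Real.zero_rpow (by linarith), sub_zero,
      ← mul_div_assoc, ← Real.rpow_add hY]
    ring_nf
    simp
    ring
  · refine (ae_restrict_iff' measurableSet_Ioc).2 (ae_of_all _ fun x hx => ?_)
    have := hx.1
    simp only [Pi.zero_apply]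
    positivity

lemma lint_pow_high (Y : ℝ) (hY : 0 < Y) :
    ∫⁻ x in Ioi Y, ENNReal.ofReal ((Y / x) ^ 2) = ENNReal.ofReal Y := by
  have hi' : IntegrableOn (fun x : ℝ => x ^ (-2 : ℝ)) (Ioi Y) :=
    integrableOn_Ioi_rpow_of_lt (by norm_num) hY
  have e : ∀ x ∈ Ioi Y, ENNReal.ofReal ((Y / x) ^ 2) =
      ENNReal.ofReal (Y ^ 2 * x ^ (-2 : ℝ)) := by
    intro x hx
    have hx0 : 0 < x := hY.trans hx
    rw [div_pow, Real.rpow_neg hx0.le, Real.rpow_two]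
    rfl
  rw [setLIntegral_congr_fun measurableSet_Ioi e,
    ← ofReal_integral_eq_lintegral_ofReal (hi'.const_mul _)]
  · congr 1
    rw [integral_const_mul, integral_Ioi_rpow_of_lt (by norm_num) hY]
    have : (-2 : ℝ) + 1 = -1 := by norm_num
    rw [this, Real.rpow_neg_one]
    field_simp
  · refine (ae_restrict_iff' measurableSet_Ioi).2 (ae_of_all _ fun x hx => ?_)
    have hx0 : 0 < x := hY.trans hx
    simp only [Pi.zero_apply]
    positivity

section dist
variable {Ω : Type*} [MeasurableSpace Ω] {T : Ω → Ω} {μ : Measure Ω} {χ : Ω → ℝ}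

lemma tail_anti [IsProbabilityMeasure μ] : Antitone (fun x => μ.real {ω | x < χ ω}) := by
  intro x y hxy
  exact measureReal_mono (fun ω (h : y < χ ω) => lt_of_le_of_lt hxy h)

lemma distF_eq [IsProbabilityMeasure μ] (hχ : Measurable χ) (x : ℝ) :
    distF μ χ x = 1 - μ.real {ω | x < χ ω} := by
  have : {ω | χ ω ≤ x} = {ω | x < χ ω}ᶜ := by ext; simp
  unfold distF
  rw [this]
  have := probReal_compl_eq_one_sub (μ := μ) (measurableSet_lt (measurable_const (a := x)) hχ)
  exact this

lemma tail_right_cont [IsProbabilityMeasure μ] (hχ : Measurable χ) (g t : ℝ)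
    (h : ∀ x, g < x → μ.real {ω | x < χ ω} ≤ t) : μ.real {ω | g < χ ω} ≤ t := by
  have hU : {ω | g < χ ω} = ⋃ k : ℕ, {ω | g + 1 / ((k : ℝ) + 1) < χ ω} := by
    ext ω
    simp only [mem_ofPred_eq, mem_iUnion]
    constructor
    · intro hg
      obtain ⟨k, hk⟩ := exists_nat_one_div_lt (sub_pos.2 hg)
      exact ⟨k, by linarith⟩
    · rintro ⟨k, hk⟩
      have : (0 : ℝ) < 1 / ((k : ℝ) + 1) := by positivity
      linarith
  have hmono : Monotone (fun k : ℕ => {ω | g + 1 / ((k : ℝ) + 1) < χ ω}) := by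
    intro k l hkl ω hω
    simp only [mem_ofPred_eq] at hω ⊢
    have : 1 / ((l : ℝ) + 1) ≤ 1 / ((k : ℝ) + 1) := by
      apply one_div_le_one_div_of_le (by positivity)
      have : (k : ℝ) ≤ l := by exact_mod_cast hkl
      linarith
    linarith
  have hlim := tendsto_measure_iUnion_atTop (μ := μ) hmono
  rw [← hU] at hlim
  have hlim' := (ENNReal.tendsto_toReal (measure_ne_top μ {ω | g < χ ω})).comp hlim
  refine le_of_tendsto' hlim' fun k => ?_
  refine h _ ?_
  have : (0 : ℝ) < 1 / ((k : ℝ) + 1) := by positivity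
  linarith

lemma genInv_spec [IsProbabilityMeasure μ] (hχ : Measurable χ) (h0 : ∀ ω, 0 ≤ χ ω) (t : ℝ)
    (ht1 : t < 1) (X : ℝ) (hX : μ.real {ω | X < χ ω} ≤ t) :
    (∀ x, x < genInv (distF μ χ) (1 - t) → t < μ.real {ω | x < χ ω}) ∧
    μ.real {ω | genInv (distF μ χ) (1 - t) < χ ω} ≤ t ∧
    (∀ Z, t < μ.real {ω | Z < χ ω} → Z ≤ genInv (distF μ χ) (1 - t)) := by
  have hset : {x : ℝ | 1 - t ≤ distF μ χ x} = {x | μ.real {ω | x < χ ω} ≤ t} := by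
    ext x
    simp only [mem_ofPred_eq]
    rw [distF_eq hχ]
    constructor <;> intro h <;> linarith
  unfold genInv
  rw [hset]
  set S := {x | μ.real {ω | x < χ ω} ≤ t} with hS
  have hlow : ∀ x ∈ S, ∀ Z, t < μ.real {ω | Z < χ ω} → Z ≤ x := by
    intro x hx Z hZ
    by_contra hc
    push Not at hc
    have := tail_anti (μ := μ) (χ := χ) hc.le
    simp only [hS, mem_ofPred_eq] at hx this
    linarith
  have hne : S.Nonempty := ⟨X, hX⟩
  have hbb : BddBelow S := by
    refine ⟨-1, fun x hx => hlow x hx (-1) ?_⟩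
    have : {ω | (-1 : ℝ) < χ ω} = univ := by
      ext ω; simp; linarith [h0 ω]
    rw [this]; simpa using ht1
  refine ⟨fun x hx => ?_, ?_, fun Z hZ => le_csInf hne fun x hx => hlow x hx Z hZ⟩
  · by_contra hc
    push Not at hc
    exact absurd (csInf_le hbb hc) (not_le.2 hx)
  · refine tail_right_cont hχ _ _ fun x hx => ?_
    obtain ⟨y, hy, hyx⟩ := exists_lt_of_csInf_lt hne hx
    exact (tail_anti (μ := μ) (χ := χ) hyx.le).trans hy

lemma trunc_lower [IsProbabilityMeasure μ] (hT : MeasurePreserving T μ μ) (hχ : Measurable χ)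
    (h0 : ∀ ω, 0 ≤ χ ω) (n : ℕ) (g : ℝ) :
    0 ≤ ∫ ω, truncSumN T χ n g ω ∂μ ∧ ∫⁻ x in Ioc 0 g,
      ENNReal.ofReal (n * (μ.real {ω | x < χ ω} - μ.real {ω | g < χ ω})) ≤
      ENNReal.ofReal (∫ ω, truncSumN T χ n g ω ∂μ) := by
  set f : Ω → ℝ := fun ω => if χ ω ≤ g then χ ω else 0 with hf
  have hfm : Measurable f := Measurable.ite (measurableSet_le hχ measurable_const) hχ
    measurable_const
  have hf0 : ∀ ω, 0 ≤ f ω := fun ω => by simp only [hf]; split_ifs; exacts [h0 ω, le_rfl]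
  have hfb : ∀ ω, f ω ≤ |g| := fun ω => by
    simp only [hf]; split_ifs with h
    exacts [h.trans (le_abs_self g), abs_nonneg _]
  have hfi : Integrable f μ := Integrable.of_bound hfm.aestronglyMeasurable |g|
    (ae_of_all _ fun ω => by rw [Real.norm_eq_abs, abs_of_nonneg (hf0 ω)]; exact hfb ω)
  have hInteg : ∫ ω, truncSumN T χ n g ω ∂μ = n * ∫ ω, f ω ∂μ := by
    have e : ∀ ω, truncSumN T χ n g ω = ∑ k ∈ Finset.range n, f (T^[k] ω) := fun ω => rfl
    simp_rw [e]
    rw [integral_finsetSum]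
    · rw [Finset.sum_congr rfl fun k _ => show ∫ ω, f (T^[k] ω) ∂μ = ∫ ω, f ω ∂μ from ?_]
      · simp
      · rw [← integral_map (φ := T^[k]) (f := f) (hT.iterate k).measurable.aemeasurable
          hfm.aestronglyMeasurable, (hT.iterate k).map_eq]
    · intro k _
      exact (hT.iterate k).integrable_comp_of_integrable hfi
  rw [hInteg]
  refine ⟨mul_nonneg (by positivity) (integral_nonneg hf0), ?_⟩
  rw [ENNReal.ofReal_mul (by positivity), ofReal_integral_eq_lintegral_ofReal hfi
    (ae_of_all _ hf0), lintegral_eq_lintegral_meas_lt μ (ae_of_all _ hf0) hfm.aemeasurable]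
  simp_rw [ENNReal.ofReal_mul (Nat.cast_nonneg n : (0 : ℝ) ≤ n)]
  rw [lintegral_const_mul']
  swap
  · exact ENNReal.ofReal_ne_top
  refine mul_le_mul_right ?_ _
  refine (setLIntegral_mono' measurableSet_Ioc fun x hx => ?_).trans
    (lintegral_mono_set Ioc_subset_Ioi_self)
  have hd : μ.real {ω | x < χ ω} - μ.real {ω | g < χ ω} = μ.real {ω | x < f ω} := by
    have hsub : {ω | g < χ ω} ⊆ {ω | x < χ ω} := fun ω (h : g < χ ω) => lt_of_le_of_lt hx.2 h
    rw [← measureReal_sdiff hsub (measurableSet_lt measurable_const hχ)]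
    congr 1
    ext ω
    simp only [hf, Set.mem_sdiff, mem_ofPred_eq, not_lt]
    split_ifs with h
    · simp [h]
    · have := hx.1
      simp [h]
      linarith
  rw [hd, measureReal_def, ENNReal.ofReal_toReal (measure_ne_top _ _)]

end dist

section assembly
variable {Ω : Type*} [MeasurableSpace Ω] {T : Ω → Ω} {μ : Measure Ω} {χ : Ω → ℝ}
variable {r : ℕ} {ψ : ℝ}

lemma trimmed_lint [IsProbabilityMeasure μ] (hT : Measurable T) (hχ : Measurable χ)
    (h0 : ∀ ω, 0 ≤ χ ω) (n b : ℕ) :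
    ∫⁻ ω, ENNReal.ofReal (trimmedSumN T χ n b ω) ∂μ ≤
      ∫⁻ x in Ioi (0 : ℝ), ∫⁻ ω, ((cntN T χ 1 n x ω - b : ℕ) : ℝ≥0∞) ∂μ := by
  refine (lintegral_mono fun ω => (trimmed_le T χ h0 n b ω).2).trans (le_of_eq ?_)
  rw [lintegral_lintegral_swap]
  refine Measurable.aemeasurable ?_
  have hm : Measurable (fun z : Ω × ℝ => cntN T χ 1 n z.2 z.1) := by
    unfold cntN
    refine Finset.measurable_sum _ fun i _ => ?_
    refine Measurable.ite ?_ measurable_const measurable_const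
    exact measurableSet_lt measurable_snd ((hχ.comp (hT.iterate _)).comp measurable_fst)
  exact (measurable_from_nat (f := fun k : ℕ => ((k - b : ℕ) : ℝ≥0∞))).comp hm

lemma key_bound [IsProbabilityMeasure μ] (hT : MeasurePreserving T μ μ) (hχ : Measurable χ)
    (h0 : ∀ ω, 0 ≤ χ ω)
    (hψ : ∀ k, 1 ≤ k → ∀ B C : Set Ω, MeasurableSet[sigmaIcc T χ 1 k] B →
      MeasurableSet[sigmaIci T χ (k + r)] C →
      |μ.real (B ∩ C) - μ.real B * μ.real C| ≤ ψ * (μ.real B * μ.real C))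
    (hψ0 : 0 ≤ ψ) (hψ1 : ψ < 1) (hr : 1 ≤ r) (n b K q : ℕ) (hq : 1 ≤ q) (η β g Y : ℝ)
    (hη : 0 ≤ η) (hη1 : η ≤ 1) (hK : 3 * ((1 + ψ) / 2) ^ K ≤ η ^ 2)
    (hg : 0 < g) (hgY : g ≤ Y) (hn1 : n ≤ r * (2 ^ K * q))
    (hn2 : (r : ℝ) * ((2 ^ K * q : ℕ) : ℝ) ≤ n + η * n)
    (hgb : n * μ.real {ω | g < χ ω} ≤ b) (hqY : 1 ≤ q * μ.real {ω | Y < χ ω})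
    (hβ : 2 ≤ β * (b / r)) (hβ0 : 0 < β)
    (htail : ∀ x, Y < x → Real.exp 2 * (((2 ^ K * q : ℕ) : ℝ) * μ.real {ω | x < χ ω}) ≤
      (Y / x) ^ β * (b / r)) :
    ∫⁻ ω, ENNReal.ofReal (trimmedSumN T χ n b ω) ∂μ ≤
      (∫⁻ x in Ioc 0 g, ENNReal.ofReal (n * (μ.real {ω | x < χ ω} - μ.real {ω | g < χ ω}))) +
      (∫⁻ x in Ioc 0 Y, ENNReal.ofReal (3 * η * n) * ENNReal.ofReal (μ.real {ω | x < χ ω})) +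
      (∫⁻ x in Ioi Y, ENNReal.ofReal r * ENNReal.ofReal ((Y / x) ^ 2)) := by
  refine (trimmed_lint hT.measurable hχ h0 n b).trans ?_
  have hr' : (0 : ℝ) < r := by exact_mod_cast hr
  have hY : 0 < Y := hg.trans_le hgY
  set p : ℝ → ℝ := fun x => μ.real {ω | x < χ ω} with hp
  have hpa : Antitone p := tail_anti
  have hp0 : ∀ x, 0 ≤ p x := fun x => measureReal_nonneg
  set M := 2 ^ K * q with hM
  have hu : Ioi (0 : ℝ) = Ioc 0 Y ∪ Ioi Y := (Ioc_union_Ioi_eq_Ioi hY.le).symm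
  rw [hu, lintegral_union measurableSet_Ioi (Ioc_disjoint_Ioi le_rfl)]
  refine add_le_add ?_ ?_
  · have hpt : ∀ x ∈ Ioc 0 Y, ∫⁻ ω, ((cntN T χ 1 n x ω - b : ℕ) : ℝ≥0∞) ∂μ ≤
        (Iic g).indicator (fun x => ENNReal.ofReal (n * (p x - p g))) x +
          ENNReal.ofReal (3 * η * n) * ENNReal.ofReal (p x) := by
      intro x hx
      refine (cnt_full hT hχ hr M n hn1 b x).trans ?_
      have hqx : 1 ≤ q * p x := hqY.trans (mul_le_mul_of_nonneg_left (hpa hx.2) (by positivity))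
      have hb := cnt_bulk hT hχ hψ hψ0 hψ1 q hq x hqx K η hη hK (b / r)
      have hb2 := mul_le_mul_of_nonneg_left hb hr'.le
      refine (ENNReal.ofReal_le_ofReal hb2).trans ?_
      change ENNReal.ofReal (r * (max (M * p x - b / r) 0 + η * (M * p x))) ≤ _
      have e : (r : ℝ) * (max (M * p x - b / r) 0 + η * (M * p x)) =
          max ((r * M) * p x - b) 0 + η * ((r * M) * p x) := by
        rw [mul_add, mul_max_of_nonneg _ _ hr'.le, mul_sub, mul_div_cancel₀ _ hr'.ne']
        ring_nf
      rw [e, ← ENNReal.ofReal_mul (by positivity)]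
      have hpx := hp0 x
      have h1 : (r * M : ℝ) * p x ≤ (n + η * n) * p x := mul_le_mul_of_nonneg_right hn2 hpx
      have hnp : 0 ≤ (n : ℝ) * p x := by positivity
      have h2 : η * ((r * M : ℝ) * p x) ≤ η * (2 * (n * p x)) := by
        refine mul_le_mul_of_nonneg_left (h1.trans ?_) hη
        nlinarith
      have h3 : 0 ≤ η * (n * p x) := by positivity
      by_cases hxg : x ≤ g
      · rw [indicator_of_mem (show x ∈ Iic g from hxg)]
        have h4 : 0 ≤ n * (p x - p g) := mul_nonneg (by positivity) (sub_nonneg.2 (hpa hxg))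
        rw [← ENNReal.ofReal_add h4 (by positivity)]
        refine ENNReal.ofReal_le_ofReal ?_
        have : max ((r * M : ℝ) * p x - b) 0 ≤ n * (p x - p g) + η * (n * p x) := by
          refine max_le ?_ (by positivity)
          have : (n : ℝ) * p g ≤ b := hgb
          linarith
        linarith
      · rw [indicator_of_notMem (show x ∉ Iic g from hxg), zero_add]
        refine ENNReal.ofReal_le_ofReal ?_
        have : max ((r * M : ℝ) * p x - b) 0 ≤ η * (n * p x) := by
          refine max_le ?_ (by positivity)
          have h5 : (n : ℝ) * p g ≤ b := hgb
          have h6 : (n : ℝ) * p x ≤ n * p g :=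
            mul_le_mul_of_nonneg_left (hpa (not_le.1 hxg).le) (by positivity)
          linarith
        linarith
    refine (setLIntegral_mono' measurableSet_Ioc hpt).trans ?_
    rw [lintegral_add_right]
    · refine add_le_add ?_ le_rfl
      rw [setLIntegral_indicator measurableSet_Iic]
      exact lintegral_mono_set fun x hx => ⟨hx.2.1, hx.1⟩
    · exact (ENNReal.measurable_ofReal.comp hpa.measurable).const_mul _
  · refine setLIntegral_mono' measurableSet_Ioi fun x hx => ?_
    refine (cnt_full hT hχ hr M n hn1 b x).trans ?_
    have hx0 : 0 < x := hY.trans hx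
    have hyx : Y / x ≤ 1 := (div_le_one hx0).2 (le_of_lt hx)
    have hyx0 : 0 < Y / x := by positivity
    have ht := cnt_tail hT hχ hψ hψ1 M x (b / r) ((Y / x) ^ β) (by positivity)
      (Real.rpow_le_one hyx0.le hyx hβ0.le) (htail x hx)
    rw [← ENNReal.ofReal_mul hr'.le]
    refine ENNReal.ofReal_le_ofReal (mul_le_mul_of_nonneg_left (ht.trans ?_) hr'.le)
    rw [← Real.rpow_mul hyx0.le, ← Real.rpow_two]
    exact Real.rpow_le_rpow_of_exponent_ge hyx0 hyx hβ

end assembly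

section final
variable {Ω : Type*} [MeasurableSpace Ω] {T : Ω → Ω} {μ : Measure Ω} {χ : Ω → ℝ}

lemma int_low (p : ℝ → ℝ) (hp0 : ∀ x, 0 ≤ p x) (hp1 : ∀ x, p x ≤ 1) (x0 γ : ℝ) (hx0 : 1 ≤ x0)
    (hγ0 : 0 < γ) (hγ : γ < 1) (hpx : 0 < p x0)
    (hpot : ∀ y x, x0 ≤ y → y ≤ x → p y ≤ 2 * p x * (x / y) ^ γ) (Y : ℝ) (hY : x0 ≤ Y) :
    ∫⁻ x in Ioc 0 Y, ENNReal.ofReal (p x) ≤ ENNReal.ofReal (2 / p x0 * p Y * (Y / (1 - γ))) := by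
  have hY0 : 0 < Y := by linarith
  have hpt : ∀ x ∈ Ioc 0 Y, ENNReal.ofReal (p x) ≤
      ENNReal.ofReal (2 / p x0 * p Y) * ENNReal.ofReal ((Y / x) ^ γ) := by
    intro x hx
    have hx1 := hx.1
    have hpY := hp0 Y
    rw [← ENNReal.ofReal_mul (by positivity)]
    refine ENNReal.ofReal_le_ofReal ?_
    have e : 2 / p x0 * p Y * (Y / x) ^ γ = (2 * p Y * (Y / x) ^ γ) / p x0 := by ring
    rw [e, le_div_iff₀ hpx]
    rcases le_total x0 x with h | h
    · have h1 := hpot x Y h hx.2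
      have := mul_le_mul_of_nonneg_left (hp1 x0) (hp0 x)
      linarith
    · have h1 := hpot x0 Y le_rfl hY
      have h2 : p x * p x0 ≤ p x0 := by nlinarith [hp1 x]
      refine h2.trans (h1.trans (mul_le_mul_of_nonneg_left ?_ (by positivity)))
      refine Real.rpow_le_rpow (by positivity) ?_ hγ0.le
      exact div_le_div_of_nonneg_left hY0.le hx1 h
  refine (setLIntegral_mono' measurableSet_Ioc hpt).trans ?_
  rw [lintegral_const_mul' _ _ ENNReal.ofReal_ne_top, lint_pow_low Y γ hY0 hγ,
    ← ENNReal.ofReal_mul (by have := hp0 Y; positivity)]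

lemma zeta_bound (b : ℕ) (hb : 8 ≤ b) : (b : ℝ) ^ ((2 : ℝ) / 3) ≤ b / 2 := by
  have hb' : (8 : ℝ) ≤ b := by exact_mod_cast hb
  have hb0 : (0 : ℝ) < b := by linarith
  have h1 : (b : ℝ) = (b : ℝ) ^ ((2 : ℝ) / 3) * (b : ℝ) ^ ((1 : ℝ) / 3) := by
    rw [← Real.rpow_add hb0]; norm_num
  have h2 : (2 : ℝ) ≤ (b : ℝ) ^ ((1 : ℝ) / 3) := by
    have h8 : (8 : ℝ) ^ ((1 : ℝ) / 3) = 2 := by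
      rw [show (8 : ℝ) = 2 ^ (3 : ℝ) by norm_num, ← Real.rpow_mul (by norm_num)]; norm_num
    rw [← h8]
    exact Real.rpow_le_rpow (by norm_num) hb' (by norm_num)
  have h3 : (0 : ℝ) < (b : ℝ) ^ ((2 : ℝ) / 3) := by positivity
  nlinarith

end final

set_option maxHeartbeats 4000000 in
theorem trimmed_sum_upper_bound_by_truncated
    {Ω : Type*} [MeasurableSpace Ω] (T : Ω → Ω) (μ : Measure Ω)
    {F : Type*} [NormedRing F] [NormedAlgebra ℝ F] [CompleteSpace F]
    (ι : F →ₐ[ℝ] Ω → ℝ) (χ : Ω → ℝ)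
    (hD : PropertyD T μ ι χ)
    (L : ℝ → ℝ) (hL : SlowlyVarying L) (hLpos : ∀ x : ℝ, 0 < x → 0 < L x)
    {α : ℝ} (hα0 : 0 < α) (hα1 : α < 1)
    (htail : ∀ x : ℝ, 0 < x → (μ {ω | x < χ ω}).toReal = L x / x ^ α)
    (b : ℕ → ℕ) (hb : Tendsto b atTop atTop)
    (hbo : Tendsto (fun n => (b n : ℝ) / (n : ℝ)) atTop (𝓝 0))
    (hmix : ∃ r : ℕ, 1 ≤ r ∧ psiCoeff μ T χ r < 1)
    :
    ∀ ε : ℝ, 0 < ε → ∃ N : ℕ, ∀ n ≥ N,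
      ∫ ω, trimmedSumN T χ n (b n) ω ∂μ ≤
        (1 + ε) * ∫ ω, truncSumN T χ n (gSeq μ χ b n) ω ∂μ := by
  intro ε hε
  haveI := hD.prob
  have hT := hD.invariant
  have hχ := hD.chi_meas
  have h0 := hD.chi_nonneg
  obtain ⟨r, hr, hψr⟩ := hmix
  obtain ⟨ψ, hψ0, hψ1, hψ⟩ := psi_ineq T μ χ r hψr
  have hr' : (0 : ℝ) < r := by exact_mod_cast hr
  set p : ℝ → ℝ := fun x => μ.real {ω | x < χ ω} with hp
  have hpa : Antitone p := tail_anti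
  have hp0 : ∀ x, 0 ≤ p x := fun x => measureReal_nonneg
  have hp1 : ∀ x, p x ≤ 1 := fun x => measureReal_le_one
  have hpL : ∀ x, 0 < x → p x = L x / x ^ α := htail
  have hpos : ∀ x, 0 < x → 0 < p x := fun x hx => by
    rw [hpL x hx]; exact div_pos (hLpos x hx) (by positivity)
  have hlim : Tendsto (fun x => p (2 * x) / p x) atTop (𝓝 ((2 : ℝ) ^ (-α))) := by
    have h := (hL 2 (by norm_num)).mul_const ((2 : ℝ) ^ (-α))
    rw [one_mul] at h
    refine h.congr' ?_
    filter_upwards [eventually_gt_atTop 0] with x hx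
    rw [hpL x hx, hpL (2 * x) (by positivity), Real.mul_rpow (by norm_num) hx.le,
      Real.rpow_neg (by norm_num)]
    have := hLpos x hx
    have : (0 : ℝ) < x ^ α := by positivity
    have : (0 : ℝ) < 2 ^ α := by positivity
    field_simp
  obtain ⟨x0, hx0, hdbl, hpotU, hpotL⟩ := potter p hpa hpos α hα0 hα1 hlim
  set β := α / 2 with hβ
  set γ := (1 + α) / 2 with hγ
  have hβ0 : 0 < β := by positivity
  have hγ0 : 0 < γ := by positivity
  have hγ1 : γ < 1 := by rw [hγ]; linarith
  have hx0p : 0 < p x0 := hpos x0 (by linarith)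
  set C := 2 / p x0 / (1 - γ) with hC
  have hC0 : 0 < C := div_pos (by positivity) (by linarith)
  -- the constant A
  set A : ℝ := (8 * Real.exp 2) ^ (1 / β) with hA
  have hA8 : A ^ β = 8 * Real.exp 2 := by
    rw [hA, ← Real.rpow_mul (by positivity), one_div_mul_cancel hβ0.ne', Real.rpow_one]
  have hA1 : 1 ≤ A := by
    refine Real.one_le_rpow ?_ (by positivity)
    have := Real.one_le_exp (x := 2) (by norm_num)
    linarith
  set c0 : ℝ := (1 - (2 : ℝ) ^ (-β)) / 4 with hc0
  have hc0p : 0 < c0 := by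
    have : (2 : ℝ) ^ (-β) < 1 := Real.rpow_lt_one_of_one_lt_of_neg (by norm_num) (by linarith)
    rw [hc0]; linarith
  set η : ℝ := min 1 (ε * c0 / (6 * C * A)) with hη
  have hη0 : 0 < η := lt_min one_pos (by positivity)
  have hη1 : η ≤ 1 := min_le_left _ _
  have hη2 : η * (6 * C * A) ≤ ε * c0 := by
    rw [← le_div_iff₀ (by positivity)]; exact min_le_right _ _
  obtain ⟨K, hK⟩ : ∃ K : ℕ, ((1 + ψ) / 2) ^ K < η ^ 2 / 3 :=
    exists_pow_lt_of_lt_one (by positivity) (by linarith)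
  have hK' : 3 * ((1 + ψ) / 2) ^ K ≤ η ^ 2 := by linarith
  have hbR : Tendsto (fun n => (b n : ℝ)) atTop atTop := tendsto_natCast_atTop_atTop.comp hb
  have ev1 := hbR.eventually_ge_atTop (2 * r * A / (ε * c0))
  have ev2 := hb.eventually_ge_atTop 8
  have ev3 := hbR.eventually_ge_atTop (2 * r / β)
  have ev4 := hbR.eventually_ge_atTop (16 * r * 2 ^ K * A ^ γ)
  have ev5 := hbo.eventually_lt_const one_pos
  have ev6 := hbo.eventually_lt_const (hpos (2 * x0) (by linarith))
  have ev7 := (tendsto_natCast_atTop_atTop (R := ℝ)).eventually_ge_atTop (r * 2 ^ K / η)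
  have ev8 := eventually_ge_atTop 1
  obtain ⟨N, hN⟩ := (ev1.and (ev2.and (ev3.and (ev4.and (ev5.and (ev6.and
    (ev7.and ev8))))))).exists_forall_of_atTop
  refine ⟨N, fun n hn => ?_⟩
  obtain ⟨f1, f2, f3, f4, f5, f6, f7, f8⟩ := hN n hn
  have hn0 : (0 : ℝ) < n := by exact_mod_cast f8
  have hbn0 : (0 : ℝ) < b n := by
    have : (8 : ℝ) ≤ b n := by exact_mod_cast f2
    linarith
  set t : ℝ := ((b n : ℝ) - (b n : ℝ) ^ ((2 : ℝ) / 3)) / n with ht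
  have hζ := zeta_bound (b n) f2
  have hζ0 : (0 : ℝ) < (b n : ℝ) ^ ((2 : ℝ) / 3) := by positivity
  have htb : t ≤ b n / n := by rw [ht]; gcongr; linarith
  have htb2 : b n / 2 ≤ n * t := by
    rw [ht, mul_div_cancel₀ _ hn0.ne']; linarith
  have ht0 : 0 < t := by
    by_contra hc
    push Not at hc
    nlinarith
  -- p tends to zero
  obtain ⟨X, hX⟩ : ∃ X, p X ≤ t := by
    have hl : Tendsto (fun x : ℝ => 2 * p x0 * (x0 / x) ^ β) atTop (𝓝 (2 * p x0 * 0 ^ β)) := by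
      refine Tendsto.const_mul _ ?_
      refine Tendsto.rpow_const ?_ (Or.inr hβ0.le)
      exact tendsto_const_nhds.div_atTop tendsto_id
    rw [Real.zero_rpow hβ0.ne', mul_zero] at hl
    obtain ⟨X, h1, h2⟩ := ((hl.eventually_lt_const ht0).and (eventually_ge_atTop x0)).exists
    exact ⟨X, (hpotU x0 X le_rfl h2).trans h1.le⟩
  obtain ⟨g1, g2, g3⟩ := genInv_spec (μ := μ) hχ h0 t (htb.trans_lt f5) X hX
  have hgdef : gSeq μ χ b n = genInv (distF μ χ) (1 - t) := rfl
  rw [← hgdef] at g1 g2 g3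
  set g := gSeq μ χ b n with hg
  have hgx : 2 * x0 ≤ g := g3 _ (htb.trans_lt f6)
  have hgpos : 0 < g := by linarith
  change p g ≤ t at g2
  have hpg2 : t < p (g / 2) := g1 _ (by linarith)
  have hng : (n : ℝ) * p g ≤ b n := by
    calc (n : ℝ) * p g ≤ n * (b n / n) := mul_le_mul_of_nonneg_left (g2.trans htb) hn0.le
      _ = b n := mul_div_cancel₀ _ hn0.ne'
  have hnp2 : b n / 2 ≤ n * p (g / 2) :=
    htb2.trans (mul_le_mul_of_nonneg_left hpg2.le hn0.le)
  -- lower bound of the truncated sum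
  set D := ∫ ω, truncSumN T χ n g ω ∂μ with hDdef
  obtain ⟨hD0, hDl⟩ := trunc_lower (μ := μ) hT hχ h0 n g
  have hDlow : c0 * (b n * g) ≤ D := by
    have h1 : ENNReal.ofReal (n * (p (g / 2) - p g) * (g / 2)) ≤ ENNReal.ofReal D := by
      refine le_trans ?_ hDl
      calc ENNReal.ofReal (n * (p (g / 2) - p g) * (g / 2))
          = ∫⁻ x in Ioc 0 (g / 2), ENNReal.ofReal (n * (p (g / 2) - p g)) := by
            rw [setLIntegral_const, Real.volume_Ioc, sub_zero, ← ENNReal.ofReal_mul]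
            exact mul_nonneg hn0.le (sub_nonneg.2 (hpa (by linarith)))
        _ ≤ ∫⁻ x in Ioc 0 (g / 2), ENNReal.ofReal (n * (p x - p g)) := by
            refine setLIntegral_mono' measurableSet_Ioc fun x hx => ENNReal.ofReal_le_ofReal ?_
            have := hpa hx.2
            gcongr
        _ ≤ _ := lintegral_mono_set (Ioc_subset_Ioc_right (by linarith))
    have h2 := (ENNReal.ofReal_le_ofReal_iff hD0).1 h1
    refine le_trans ?_ h2
    have h3 := hdbl (g / 2) (by linarith)
    rw [mul_div_cancel₀ g two_ne_zero] at h3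
    have h4 : 4 * c0 * p (g / 2) ≤ p (g / 2) - p g := by rw [hc0]; linarith
    have h5 : 4 * c0 * (b n / 2) ≤ n * (p (g / 2) - p g) := by
      calc 4 * c0 * (b n / 2) ≤ 4 * c0 * (n * p (g / 2)) :=
            mul_le_mul_of_nonneg_left hnp2 (by positivity)
        _ = n * (4 * c0 * p (g / 2)) := by ring
        _ ≤ _ := mul_le_mul_of_nonneg_left h4 hn0.le
    have := mul_le_mul_of_nonneg_right h5 (by positivity : 0 ≤ g / 2)
    linarith
  -- apply the key bound
  set Y := A * g with hY
  have hgY : g ≤ Y := by rw [hY]; exact le_mul_of_one_le_left hgpos.le hA1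
  have hYpos : 0 < Y := hgpos.trans_le hgY
  have hYg : Y / g = A := by rw [hY]; field_simp
  have hgY' : g / Y = A⁻¹ := by rw [← inv_div, hYg]
  set R := r * 2 ^ K with hR
  have hR0 : 0 < R := by positivity
  set q := n / R + 1 with hq
  have hRn : R * (n / R) ≤ n := Nat.mul_div_le n R
  have hRn' : n < R * q := by rw [hq]; exact Nat.lt_mul_div_succ n hR0
  have eR : r * (2 ^ K * q) = R * q := by rw [hR]; ring
  have hn1 : n ≤ r * (2 ^ K * q) := by rw [eR]; exact hRn'.le
  have hRr : (R : ℝ) = r * 2 ^ K := by rw [hR]; push_cast; rfl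
  have hRη : (R : ℝ) ≤ η * n := by
    rw [div_le_iff₀ hη0] at f7
    rw [hRr]; linarith
  have hn2 : (r : ℝ) * ((2 ^ K * q : ℕ) : ℝ) ≤ n + η * n := by
    have e : (r : ℝ) * ((2 ^ K * q : ℕ) : ℝ) = ((R * q : ℕ) : ℝ) := by rw [← eR]; push_cast; ring
    rw [e]
    have : R * q ≤ n + R := by rw [hq, mul_add]; omega
    have : ((R * q : ℕ) : ℝ) ≤ n + R := by exact_mod_cast this
    linarith
  have hn3 : (r : ℝ) * ((2 ^ K * q : ℕ) : ℝ) ≤ 2 * n := by nlinarith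
  have hAγ : 0 < A ^ γ := by positivity
  have hqY : 1 ≤ q * p Y := by
    have h1 := hpotL (g / 2) g (by linarith) (by linarith)
    have e1 : g / (g / 2) = 2 := by field_simp
    rw [e1] at h1
    have h2γ : (2 : ℝ) ^ γ ≤ 2 := by
      simpa using Real.rpow_le_rpow_of_exponent_le (by norm_num : (1 : ℝ) ≤ 2) hγ1.le
    have h2 : p (g / 2) ≤ 4 * p g := by
      have := mul_le_mul_of_nonneg_left h2γ (by have := hp0 g; positivity : 0 ≤ 2 * p g)
      linarith
    have h3 := hpotL g Y (by linarith) hgY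
    rw [hYg] at h3
    have h4 : b n / 2 ≤ n * (8 * p Y * A ^ γ) :=
      hnp2.trans (mul_le_mul_of_nonneg_left (by linarith) hn0.le)
    have h5 : (n : ℝ) ≤ R * q := by exact_mod_cast hRn'.le
    have h6 : b n / 2 ≤ (R * q) * (8 * p Y * A ^ γ) :=
      h4.trans (mul_le_mul_of_nonneg_right h5 (by have := hp0 Y; positivity))
    have h7 : 16 * R * A ^ γ * 1 ≤ 16 * R * A ^ γ * (q * p Y) := by
      rw [hRr] at h6 ⊢
      linarith
    exact le_of_mul_le_mul_left h7 (by positivity)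
  have hβb : 2 ≤ β * (b n / r) := by
    rw [div_le_iff₀ hβ0] at f3
    rw [← mul_div_assoc, le_div_iff₀ hr']
    linarith
  have htl : ∀ x, Y < x → Real.exp 2 * (((2 ^ K * q : ℕ) : ℝ) * p x) ≤
      (Y / x) ^ β * (b n / r) := by
    intro x hx
    have hx1 : 0 < x := hYpos.trans hx
    have h1 := hpotU Y x (by linarith) hx.le
    have h2 := hpotU g Y (by linarith) hgY
    rw [hgY', Real.inv_rpow (by linarith), hA8] at h2
    have hyx : 0 < (Y / x) ^ β := by positivity
    rw [← mul_div_assoc, le_div_iff₀ hr']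
    calc Real.exp 2 * (((2 ^ K * q : ℕ) : ℝ) * p x) * r
        = Real.exp 2 * p x * (r * ((2 ^ K * q : ℕ) : ℝ)) := by ring
      _ ≤ Real.exp 2 * p x * (2 * n) :=
          mul_le_mul_of_nonneg_left hn3 (mul_nonneg (Real.exp_pos _).le (hp0 x))
      _ ≤ Real.exp 2 * (2 * (2 * p g * (8 * Real.exp 2)⁻¹) * (Y / x) ^ β) * (2 * n) := by
          gcongr
          refine h1.trans ?_
          gcongr
      _ = (Y / x) ^ β * (n * p g) := by
          have := Real.exp_pos 2
          field_simp
          ring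
      _ ≤ (Y / x) ^ β * b n := mul_le_mul_of_nonneg_left hng hyx.le
  have hkey := key_bound hT hχ h0 hψ hψ0 hψ1 hr n (b n) K q (by rw [hq]; exact Nat.le_add_left 1 _) η β g Y hη0.le hη1 hK'
    hgpos hgY hn1 hn2 hng hqY hβb hβ0 htl
  have hlow := int_low p hp0 hp1 x0 γ hx0 hγ0 hγ1 hx0p hpotL Y (by linarith)
  have hpY := hp0 Y
  have hE1 : ∫⁻ x in Ioc 0 Y, ENNReal.ofReal (3 * η * n) * ENNReal.ofReal (p x) ≤
      ENNReal.ofReal (3 * η * C * (b n * Y)) := by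
    rw [lintegral_const_mul' _ _ ENNReal.ofReal_ne_top]
    refine (mul_le_mul_right hlow _).trans ?_
    rw [← ENNReal.ofReal_mul (by positivity)]
    refine ENNReal.ofReal_le_ofReal ?_
    have h1 : (n : ℝ) * p Y ≤ b n := (mul_le_mul_of_nonneg_left (hpa hgY) hn0.le).trans hng
    calc 3 * η * n * (2 / p x0 * p Y * (Y / (1 - γ))) = 3 * η * C * Y * (n * p Y) := by
          rw [hC]; ring
      _ ≤ 3 * η * C * Y * b n := mul_le_mul_of_nonneg_left h1 (by positivity)
      _ = _ := by ring
  have hE2 : ∫⁻ x in Ioi Y, ENNReal.ofReal r * ENNReal.ofReal ((Y / x) ^ 2) =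
      ENNReal.ofReal (r * Y) := by
    rw [lintegral_const_mul' _ _ ENNReal.ofReal_ne_top, lint_pow_high Y hYpos,
      ← ENNReal.ofReal_mul hr'.le]
  have htot : ∫⁻ ω, ENNReal.ofReal (trimmedSumN T χ n (b n) ω) ∂μ ≤
      ENNReal.ofReal (D + 3 * η * C * (b n * Y) + r * Y) := by
    rw [ENNReal.ofReal_add (by positivity) (by positivity),
      ENNReal.ofReal_add hD0 (by positivity)]
    refine hkey.trans ?_
    exact add_le_add (add_le_add hDl hE1) hE2.le
  have hfin : D + 3 * η * C * (b n * Y) + r * Y ≤ (1 + ε) * D := by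
    have h1 : 3 * η * C * (b n * Y) ≤ ε * c0 / 2 * (b n * g) := by
      have := mul_le_mul_of_nonneg_right hη2 (by positivity : 0 ≤ b n * g / 2)
      rw [hY]; linarith
    have h2 : r * Y ≤ ε * c0 / 2 * (b n * g) := by
      rw [div_le_iff₀ (by positivity)] at f1
      have := mul_le_mul_of_nonneg_right f1 (by positivity : 0 ≤ g / 2)
      rw [hY]; linarith
    have h3 := mul_le_mul_of_nonneg_left hDlow hε.le
    linarith
  have htrim0 : ∀ ω, 0 ≤ trimmedSumN T χ n (b n) ω := fun ω => (trimmed_le T χ h0 n (b n) ω).1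
  refine le_trans ?_ hfin
  by_cases hInteg : Integrable (fun ω => trimmedSumN T χ n (b n) ω) μ
  · rw [← ofReal_integral_eq_lintegral_ofReal hInteg (ae_of_all _ htrim0)] at htot
    exact (ENNReal.ofReal_le_ofReal_iff (by positivity)).1 htot
  · rw [integral_undef hInteg]
    positivity
end
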